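/- For the β-biased random walk (β > 1) started at the origin on the warm-up configuration with parameter α > 0, the following holds almost surely: lim_{t→∞} X_t/t = 0 if β < e^{1/α}, and lim_{t→∞} X_t/t = (β−1)/(β+1) if β > e^{1/α}. -/

import Mathlib

open MeasureTheory Filter
open scoped ENNReal

noncomputable section

/-- Vertices of the square lattice. -/
abbrev V : Type := ℤ × ℤ

/-- Adjacency in the square lattice ℤ²: Euclidean distance one. -/
def latAdj (u v : V) : Prop := (u.1 - v.1) ^ 2 + (u.2 - v.2) ^ 2 = 1

instance : MeasurableSpace (Sym2 V) := ⊤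

open scoped Classical in
/-- One-step transition probability of the β-biased random walk on the subgraph of ℤ²
with edge set `G`: if the set `Λ` of neighbours of `z` is nonempty and contains the right
neighbour `(z.1+1, z.2)`, step to it with probability `β/(β+|Λ|-1)` and to each other
neighbour with probability `1/(β+|Λ|-1)`; if `Λ` does not contain the right neighbour, step
uniformly in `Λ`; if `Λ` is empty, stay put. -/
def transProb (β : ℝ) (G : Set (Sym2 V)) (z w : V) : ℝ :=
  if {u : V | s(z, u) ∈ G} = ∅ then (if w = z then 1 else 0)
  else
    if s(z, w) ∈ G then
      (if s(z, ((z.1 + 1, z.2) : V)) ∈ G then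
        (if w = ((z.1 + 1, z.2) : V) then
          β / (β + ({u : V | s(z, u) ∈ G}.ncard : ℝ) - 1)
        else 1 / (β + ({u : V | s(z, u) ∈ G}.ncard : ℝ) - 1))
      else 1 / ({u : V | s(z, u) ∈ G}.ncard : ℝ))
    else 0

/-- `μ` is the law of the β-biased random walk on the subgraph of ℤ² with edge set `G`,
started at `z₀`: a probability measure on trajectories whose cylinder probabilities are
the products of the one-step transition probabilities. -/
def IsWalkLaw (β : ℝ) (G : Set (Sym2 V)) (z₀ : V) (μ : Measure (ℕ → V)) : Prop :=
  IsProbabilityMeasure μ ∧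
    ∀ (n : ℕ) (f : ℕ → V), f 0 = z₀ →
      μ {ω | ∀ i ≤ n, ω i = f i} =
        ENNReal.ofReal (∏ i ∈ Finset.range n, transProb β G (f i) (f (i + 1)))

/-- The trap with anchor `(d, y)`, entrance length `e` (at height `y+1`, running leftward
from the anchor) and core length `c` (at height `y+2`, running rightward). -/
def trapEdgesAt (d y : ℤ) (e c : ℕ) : Set (Sym2 V) :=
  {s((d, y), (d, y + 1)), s((d - e, y + 1), (d - e, y + 2))} ∪
    {f | ∃ i : ℕ, i < e ∧ f = s((d - e + i, y + 1), (d - e + i + 1, y + 1))} ∪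
    {f | ∃ i : ℕ, i < c ∧ f = s((d - e + i, y + 2), (d - e + i + 1, y + 2))}

/-- Anchors of the warm-up traps: `d_n = n³`. -/
def dWarm (n : ℕ) : ℤ := (n : ℤ) ^ 3

/-- Entrance lengths of the warm-up traps: `e_n = ⌈α · log n⌉`. -/
def eWarm (α : ℝ) (n : ℕ) : ℕ := ⌈α * Real.log n⌉₊

/-- Core lengths of the warm-up traps: `c_n = n`. -/
def cWarm (n : ℕ) : ℕ := n

/-- The warm-up configuration: the nonnegative x-axis together with, for every `n ≥ n₀`,
the trap with anchor `(n³, 0)`, entrance length `⌈α log n⌉` and core length `n`. -/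
def warmupEdges (α : ℝ) (n₀ : ℕ) : Set (Sym2 V) :=
  {f | ∃ k : ℕ, f = s(((k : ℤ), 0), ((k : ℤ) + 1, 0))} ∪
    ⋃ n ∈ {m : ℕ | n₀ ≤ m}, trapEdgesAt (dWarm n) 0 (eWarm α n) (cWarm n)

/-- `n₀` is large enough that the traps present in the warm-up configuration are pairwise
disjoint: for `n₀ ≤ m < n`, both the anchor of trap `m` and the right end of its core lie
strictly to the left of the leftmost point of trap `n`. -/
def WarmupSeparated (α : ℝ) (n₀ : ℕ) : Prop :=
  ∀ m n : ℕ, n₀ ≤ m → m < n →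
    dWarm m < dWarm n - eWarm α n ∧ dWarm m - eWarm α m + cWarm m < dWarm n - eWarm α n

/-- The four lattice neighbours of a vertex. -/
def latNbrs (z : V) : Finset V :=
  {(z.1 + 1, z.2), (z.1 - 1, z.2), (z.1, z.2 + 1), (z.1, z.2 - 1)}

lemma sum_latNbrs (z : V) (f : V → ℝ) :
    ∑ w ∈ latNbrs z, f w =
      f (z.1 + 1, z.2) + f (z.1 - 1, z.2) + f (z.1, z.2 + 1) + f (z.1, z.2 - 1) := by
  unfold latNbrs
  rw [Finset.sum_insert, Finset.sum_insert, Finset.sum_insert, Finset.sum_singleton]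
  · ring
  all_goals
    simp only [Finset.mem_insert, Finset.mem_singleton, Prod.mk.injEq, not_or]
    omega

lemma latNbrs_fst {z w : V} (h : w ∈ latNbrs z) : z.1 - 1 ≤ w.1 ∧ w.1 ≤ z.1 + 1 := by
  obtain ⟨a, b⟩ := z
  obtain ⟨c, d⟩ := w
  simp only [latNbrs, Finset.mem_insert, Finset.mem_singleton, Prod.mk.injEq] at h ⊢
  omega

/-- All edges of `G` are lattice edges. -/
def IsLatticeGraph (G : Set (Sym2 V)) : Prop := ∀ z w : V, s(z, w) ∈ G → w ∈ latNbrs z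

open scoped Classical in
/-- The conductances `β ^ max x x'` for which the biased walk is reversible. -/
def edgeWt (β : ℝ) (G : Set (Sym2 V)) (z w : V) : ℝ :=
  if s(z, w) ∈ G then β ^ (max z.1 w.1) else 0

/-- The reversible measure of the biased walk. -/
def vertWt (β : ℝ) (G : Set (Sym2 V)) (z : V) : ℝ := ∑ w ∈ latNbrs z, edgeWt β G z w

lemma edgeWt_nonneg {β : ℝ} (hβ : 1 < β) (G : Set (Sym2 V)) (z w : V) : 0 ≤ edgeWt β G z w := by
  unfold edgeWt
  split_ifs
  · positivity
  · rfl

lemma edgeWt_comm (β : ℝ) (G : Set (Sym2 V)) (z w : V) : edgeWt β G z w = edgeWt β G w z := by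
  unfold edgeWt
  rw [Sym2.eq_swap, max_comm]

lemma vertWt_nonneg {β : ℝ} (hβ : 1 < β) (G : Set (Sym2 V)) (z : V) : 0 ≤ vertWt β G z :=
  Finset.sum_nonneg fun _ _ => edgeWt_nonneg hβ G _ _

lemma edgeWt_eq_zero {β : ℝ} {G : Set (Sym2 V)} (hG : IsLatticeGraph G) {z w : V}
    (h : w ∉ latNbrs z) : edgeWt β G z w = 0 :=
  if_neg fun hh => h (hG z w hh)

lemma vertWt_pos {β : ℝ} (hβ : 1 < β) {G : Set (Sym2 V)} (hG : IsLatticeGraph G) {z u : V}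
    (h : s(z, u) ∈ G) : 0 < vertWt β G z := by
  refine Finset.sum_pos' (fun _ _ => edgeWt_nonneg hβ G _ _) ⟨u, hG z u h, ?_⟩
  rw [edgeWt, if_pos h]
  positivity

lemma vertWt_le {β : ℝ} (hβ : 1 < β) (G : Set (Sym2 V)) (z : V) :
    vertWt β G z ≤ (β + 3) * β ^ z.1 := by
  have hb : 0 < β := by linarith
  have key : ∀ w : V, edgeWt β G z w ≤ β ^ max z.1 w.1 := fun w => by
    unfold edgeWt
    split_ifs
    · rfl
    · positivity
  rw [vertWt, sum_latNbrs]
  have h1 := key (z.1 + 1, z.2)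
  have h2 := key (z.1 - 1, z.2)
  have h3 := key (z.1, z.2 + 1)
  have h4 := key (z.1, z.2 - 1)
  simp only [max_self] at h3 h4
  rw [max_eq_right (by simp), zpow_add_one₀ hb.ne'] at h1
  rw [max_eq_left (by simp)] at h2
  linarith

lemma transProb_eq_div {β : ℝ} (hβ : 1 < β) {G : Set (Sym2 V)} (hG : IsLatticeGraph G)
    {z u : V} (hu : s(z, u) ∈ G) (w : V) :
    transProb β G z w = edgeWt β G z w / vertWt β G z := by
  classical
  have hb : 0 < β := by linarith
  have hne : {u : V | s(z, u) ∈ G} ≠ ∅ := Set.Nonempty.ne_empty ⟨u, hu⟩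
  have hset : {u : V | s(z, u) ∈ G} = ↑((latNbrs z).filter fun u => s(z, u) ∈ G) := by
    ext v
    simp only [Set.mem_ofPred_eq, Finset.coe_filter]
    exact ⟨fun h => ⟨hG z v h, h⟩, fun h => h.2⟩
  have hcard : (({u : V | s(z, u) ∈ G}.ncard : ℕ) : ℝ) =
      ∑ w ∈ latNbrs z, if s(z, w) ∈ G then (1 : ℝ) else 0 := by
    rw [hset, Set.ncard_coe_finset, Finset.card_filter]
    push_cast
    rfl
  have hx : (0 : ℝ) < β ^ z.1 := by positivity
  have hmr : max z.1 (z.1 + 1) = z.1 + 1 := max_eq_right (by simp)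
  have hml : max z.1 (z.1 - 1) = z.1 := max_eq_left (by simp)
  have hv : vertWt β G z = β ^ z.1 * (({u : V | s(z, u) ∈ G}.ncard : ℝ) +
      if s(z, ((z.1 + 1, z.2) : V)) ∈ G then β - 1 else 0) := by
    rw [hcard, vertWt, sum_latNbrs, sum_latNbrs]
    simp only [edgeWt, hmr, hml, max_self, zpow_add_one₀ hb.ne']
    split_ifs <;> ring
  rw [transProb, if_neg hne]
  by_cases hw : s(z, w) ∈ G
  · rw [if_pos hw, hv, edgeWt, if_pos hw]
    by_cases hr : s(z, ((z.1 + 1, z.2) : V)) ∈ G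
    · rw [if_pos hr, if_pos hr]
      by_cases hwr : w = (z.1 + 1, z.2)
      · subst hwr
        simp only [if_true, hmr, zpow_add_one₀ hb.ne']
        rw [mul_div_mul_left _ _ hx.ne']
        congr 1
        ring
      · rw [if_neg hwr]
        have hm : max z.1 w.1 = z.1 := by
          have := hG z w hw
          obtain ⟨a, b⟩ := z
          obtain ⟨c, d⟩ := w
          simp only [latNbrs, Finset.mem_insert, Finset.mem_singleton, Prod.mk.injEq] at this hwr ⊢
          omega
        rw [hm, ← mul_div_mul_left (1 : ℝ) _ hx.ne', mul_one]
        congr 2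
        ring
    · rw [if_neg hr, if_neg hr]
      have hm : max z.1 w.1 = z.1 := by
        have := hG z w hw
        have hwr : w ≠ (z.1 + 1, z.2) := fun h => hr (h ▸ hw)
        obtain ⟨a, b⟩ := z
        obtain ⟨c, d⟩ := w
        simp only [latNbrs, Finset.mem_insert, Finset.mem_singleton, Prod.mk.injEq, ne_eq]
          at this hwr ⊢
        omega
      rw [hm, ← mul_div_mul_left (1 : ℝ) _ hx.ne', mul_one, add_zero]
  · rw [if_neg hw, edgeWt, if_neg hw, zero_div]

lemma vertWt_mul_transProb {β : ℝ} (hβ : 1 < β) {G : Set (Sym2 V)} (hG : IsLatticeGraph G)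
    (z w : V) : vertWt β G z * transProb β G z w = edgeWt β G z w := by
  by_cases h : ∃ u, s(z, u) ∈ G
  · obtain ⟨u, hu⟩ := h
    rw [transProb_eq_div hβ hG hu, mul_div_cancel₀ _ (vertWt_pos hβ hG hu).ne']
  · push Not at h
    have h0 : ∀ v, edgeWt β G z v = 0 := fun v => if_neg (h v)
    rw [h0, vertWt, Finset.sum_eq_zero fun v _ => h0 v, zero_mul]

lemma transProb_of_isolated {β : ℝ} {G : Set (Sym2 V)} {z : V} (h : ∀ u, s(z, u) ∉ G) (w : V) :
    transProb β G z w = if w = z then 1 else 0 := by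
  have : {u : V | s(z, u) ∈ G} = ∅ := by
    ext u
    simp [h u]
  rw [transProb, if_pos this]

lemma transProb_nonneg {β : ℝ} (hβ : 1 < β) {G : Set (Sym2 V)} (hG : IsLatticeGraph G)
    (z w : V) : 0 ≤ transProb β G z w := by
  by_cases h : ∃ u, s(z, u) ∈ G
  · obtain ⟨u, hu⟩ := h
    rw [transProb_eq_div hβ hG hu]
    exact div_nonneg (edgeWt_nonneg hβ G _ _) (vertWt_nonneg hβ G _)
  · push Not at h
    rw [transProb_of_isolated h]
    split_ifs <;> norm_num

lemma tsum_transProb_mul_le {β : ℝ} (hβ : 1 < β) {G : Set (Sym2 V)} (hG : IsLatticeGraph G)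
    {z u : V} (hu : s(z, u) ∈ G) {f : V → ℝ} {K : ℝ} (hf : ∀ w, 0 ≤ f w)
    (h : ∑ w ∈ latNbrs z, edgeWt β G z w * f w ≤ K * vertWt β G z) :
    ∑' w, ENNReal.ofReal (transProb β G z w) * ENNReal.ofReal (f w) ≤ ENNReal.ofReal K := by
  rw [tsum_eq_sum (s := latNbrs z)]
  · simp_rw [← ENNReal.ofReal_mul (transProb_nonneg hβ hG _ _)]
    rw [← ENNReal.ofReal_sum_of_nonneg
      fun w _ => mul_nonneg (transProb_nonneg hβ hG _ _) (hf w)]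
    apply ENNReal.ofReal_le_ofReal
    simp_rw [transProb_eq_div hβ hG hu, div_mul_eq_mul_div]
    rw [← Finset.sum_div, div_le_iff₀ (vertWt_pos hβ hG hu)]
    exact h
  · intro w hw
    rw [transProb_eq_div hβ hG hu, edgeWt_eq_zero hG hw]
    simp

/-- The Markov property: averaging over the next step given the history. -/
lemma IsWalkLaw.lintegral_succ {β : ℝ} (hβ : 1 < β) {G : Set (Sym2 V)} (hG : IsLatticeGraph G)
    {z₀ : V} {μ : Measure (ℕ → V)} (hμ : IsWalkLaw β G z₀ μ) (t : ℕ)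
    (F : (ℕ → V) → V → ℝ≥0∞) (hF : ∀ ω ω' : ℕ → V, (∀ i ≤ t, ω i = ω' i) → F ω = F ω') :
    ∫⁻ ω, F ω (ω (t + 1)) ∂μ =
      ∫⁻ ω, ∑' w, ENNReal.ofReal (transProb β G (ω t) w) * F ω w ∂μ := by
  have hprob := hμ.1
  let pre : (ℕ → V) → (Fin (t + 1) → V) := fun ω i => ω i
  let ext : (Fin (t + 1) → V) → (ℕ → V) := fun g i => g ⟨min i t, by omega⟩
  have hext : ∀ ω, ∀ i ≤ t, ext (pre ω) i = ω i := fun ω i hi => by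
    simp only [ext, pre, min_eq_left hi]
  have hextg : ∀ g (i : Fin (t + 1)), ext g i = g i := fun g i => by
    simp only [ext]
    congr 1
    ext
    simp only
    omega
  have hpre : Measurable pre := measurable_pi_lambda _ fun i => measurable_pi_apply _
  have hpair : Measurable fun ω : ℕ → V => (pre ω, ω (t + 1)) :=
    hpre.prodMk (measurable_pi_apply _)
  have hcyl : ∀ g w, μ ((fun ω : ℕ → V => (pre ω, ω (t + 1))) ⁻¹' {(g, w)}) =
      ENNReal.ofReal (transProb β G (ext g t) w) * μ (pre ⁻¹' {g}) := by
    intro g w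
    have hset1 : pre ⁻¹' {g} = {ω | ∀ i ≤ t, ω i = ext g i} := by
      ext ω
      simp only [Set.mem_preimage, Set.mem_singleton_iff, Set.mem_ofPred_eq]
      constructor
      · rintro rfl i hi
        exact (hext ω i hi).symm
      · intro h
        funext i
        rw [← hextg g i]
        exact h i (by omega)
    let f : ℕ → V := fun i => if i ≤ t then ext g i else w
    have hset2 : (fun ω : ℕ → V => (pre ω, ω (t + 1))) ⁻¹' {(g, w)} =
        {ω | ∀ i ≤ t + 1, ω i = f i} := by
      have : (fun ω : ℕ → V => (pre ω, ω (t + 1))) ⁻¹' {(g, w)} =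
        pre ⁻¹' {g} ∩ {ω | ω (t + 1) = w} := by
        ext ω
        simp
      rw [this, hset1]
      ext ω
      simp only [Set.mem_inter_iff, Set.mem_ofPred_eq, f]
      constructor
      · rintro ⟨h1, h2⟩ i hi
        split_ifs with hit
        · exact h1 i hit
        · rw [← h2]
          congr 1
          omega
      · intro h
        refine ⟨fun i hi => ?_, ?_⟩
        · rw [h i (by omega), if_pos hi]
        · rw [h _ le_rfl, if_neg (by omega)]
    have hf0 : f 0 = ext g 0 := if_pos (by omega)
    by_cases h0 : ext g 0 = z₀
    · rw [hset1, hset2, hμ.2 (t + 1) f (hf0.trans h0), hμ.2 t (ext g) h0,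
        Finset.prod_range_succ, mul_comm, ENNReal.ofReal_mul (transProb_nonneg hβ hG _ _)]
      congr 2
      · simp [f]
      · refine Finset.prod_congr rfl fun i hi => ?_
        have := Finset.mem_range.1 hi
        simp only [f]
        rw [if_pos (by omega), if_pos (by omega)]
    · have hz : μ {ω : ℕ → V | ω 0 = z₀} = 1 := by
        have := hμ.2 0 (fun _ => z₀) rfl
        simpa using this
      have hz' : μ {ω : ℕ → V | ω 0 = z₀}ᶜ = 0 := by
        rw [prob_compl_eq_one_sub (measurableSet_eq_fun (measurable_pi_apply 0)
          measurable_const), hz, tsub_self]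
      have hn : μ (pre ⁻¹' {g}) = 0 := by
        refine measure_mono_null (fun ω hω => ?_) hz'
        rw [hset1] at hω
        simp only [Set.mem_compl_iff, Set.mem_ofPred_eq]
        rw [hω 0 (by omega)]
        exact h0
      rw [hn, mul_zero]
      refine measure_mono_null (fun ω hω => ?_) hn
      simp only [Set.mem_preimage, Set.mem_singleton_iff, Prod.mk.injEq] at hω ⊢
      exact hω.1
  have hF' : ∀ ω, F ω = F (ext (pre ω)) := fun ω => hF _ _ fun i hi => (hext ω i hi).symm
  calc ∫⁻ ω, F ω (ω (t + 1)) ∂μ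
      = ∫⁻ ω, (fun q : (Fin (t + 1) → V) × V => F (ext q.1) q.2) (pre ω, ω (t + 1)) ∂μ :=
        lintegral_congr fun ω => by rw [hF' ω]
    _ = ∑' q : (Fin (t + 1) → V) × V, F (ext q.1) q.2 *
          μ ((fun ω : ℕ → V => (pre ω, ω (t + 1))) ⁻¹' {q}) := by
        rw [← lintegral_map (Measurable.of_discrete
          (f := fun q : (Fin (t + 1) → V) × V => F (ext q.1) q.2)) hpair, lintegral_countable']
        refine tsum_congr fun q => ?_
        rw [Measure.map_apply hpair (measurableSet_singleton _)]
    _ = ∑' g : Fin (t + 1) → V, (∑' w, ENNReal.ofReal (transProb β G (ext g t) w) *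
          F (ext g) w) * μ (pre ⁻¹' {g}) := by
        rw [ENNReal.tsum_prod']
        refine tsum_congr fun g => ?_
        rw [← ENNReal.tsum_mul_right]
        refine tsum_congr fun w => ?_
        rw [hcyl]
        ring
    _ = ∫⁻ ω, (fun g : Fin (t + 1) → V => ∑' w, ENNReal.ofReal (transProb β G (ext g t) w) *
          F (ext g) w) (pre ω) ∂μ := by
        rw [← lintegral_map (Measurable.of_discrete (f := fun g : Fin (t + 1) → V =>
          ∑' w, ENNReal.ofReal (transProb β G (ext g t) w) * F (ext g) w)) hpre, lintegral_countable']
        refine tsum_congr fun q => ?_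
        rw [Measure.map_apply hpre (measurableSet_singleton _)]
    _ = _ := lintegral_congr fun ω => by
        simp only
        rw [← hF' ω, hext ω t le_rfl]

lemma IsWalkLaw.ae_start {β : ℝ} {G : Set (Sym2 V)} {z₀ : V} {μ : Measure (ℕ → V)}
    (hμ : IsWalkLaw β G z₀ μ) : ∀ᵐ ω ∂μ, ω 0 = z₀ := by
  have hprob := hμ.1
  have h := hμ.2 0 (fun _ => z₀) rfl
  rw [ae_iff, show {ω : ℕ → V | ¬ ω 0 = z₀} = {ω : ℕ → V | ω 0 = z₀}ᶜ from rfl,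
    prob_compl_eq_one_sub (measurableSet_eq_fun (measurable_pi_apply 0) measurable_const)]
  simp at h
  rw [h, tsub_self]

lemma IsWalkLaw.ae_path {β : ℝ} (hβ : 1 < β) {G : Set (Sym2 V)} (hG : IsLatticeGraph G)
    {z₀ u : V} (hu : s(z₀, u) ∈ G) {μ : Measure (ℕ → V)} (hμ : IsWalkLaw β G z₀ μ) :
    ∀ᵐ ω ∂μ, ∀ t, s(ω t, ω (t + 1)) ∈ G := by
  classical
  have hstep : ∀ᵐ ω ∂μ, ∀ t, (∃ v, s(ω t, v) ∈ G) → s(ω t, ω (t + 1)) ∈ G := by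
    rw [ae_all_iff]
    intro t
    let F : (ℕ → V) → V → ℝ≥0∞ := fun ω w =>
      if (∃ v, s(ω t, v) ∈ G) ∧ s(ω t, w) ∉ G then 1 else 0
    have h := hμ.lintegral_succ hβ hG t F fun ω ω' hω => by
      simp only [F, hω t le_rfl]
    have h0 : ∫⁻ ω, F ω (ω (t + 1)) ∂μ = 0 := by
      rw [h]
      convert lintegral_zero with ω
      rw [ENNReal.tsum_eq_zero]
      intro w
      simp only [F]
      split_ifs with hw
      · obtain ⟨⟨v, hv⟩, hw⟩ := hw
        rw [transProb_eq_div hβ hG hv, edgeWt, if_neg hw]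
        simp
      · simp
    have hm : Measurable fun ω : ℕ → V => F ω (ω (t + 1)) := by
      have := (Measurable.of_discrete (f := fun q : V × V =>
        if (∃ v, s(q.1, v) ∈ G) ∧ s(q.1, q.2) ∉ G then (1 : ℝ≥0∞) else 0)).comp
        ((measurable_pi_apply (X := fun _ : ℕ => V) t).prodMk (measurable_pi_apply (t + 1)))
      exact this
    rw [lintegral_eq_zero_iff hm] at h0
    filter_upwards [h0] with ω hω hv
    obtain ⟨v, hv⟩ := hv
    by_contra hc
    simp [F, hc] at hω
    exact hω v.1 v.2 hv
  filter_upwards [hstep, hμ.ae_start] with ω hω h0 t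
  refine hω t ?_
  induction t with
  | zero => exact ⟨u, h0 ▸ hu⟩
  | succ t ih => exact ⟨ω t, by rw [Sym2.eq_swap]; exact hω t ih⟩

/-- Occupation bound: the occupation measure is dominated by every excessive measure. -/
lemma IsWalkLaw.occupation_le {β : ℝ} (hβ : 1 < β) {G : Set (Sym2 V)} (hG : IsLatticeGraph G)
    {z₀ : V} {μ : Measure (ℕ → V)} (hμ : IsWalkLaw β G z₀ μ) {h : V → ℝ} (hh : ∀ z, 0 ≤ h z)
    (hexc : ∀ w, (if w = z₀ then 1 else 0) + ∑ z ∈ latNbrs w, edgeWt β G w z * h z ≤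
      vertWt β G w * h w) (w : V) :
    ∑' t, μ {ω | ω t = w} ≤ ENNReal.ofReal (vertWt β G w * h w) := by
  classical
  have hprob := hμ.1
  have hrec : ∀ t w, μ {ω | ω (t + 1) = w} =
      ∑' z, ENNReal.ofReal (transProb β G z w) * μ {ω | ω t = z} := by
    intro t w
    have h1 := hμ.lintegral_succ hβ hG t (fun _ v => if v = w then 1 else 0) fun _ _ _ => rfl
    have hind : ∀ ω : ℕ → V, (if ω (t + 1) = w then (1 : ℝ≥0∞) else 0) =
        Set.indicator {ω : ℕ → V | ω (t + 1) = w} 1 ω := fun ω => by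
      simp [Set.indicator_apply]
    simp_rw [hind] at h1
    rw [lintegral_indicator_one
      (measurableSet_eq_fun (measurable_pi_apply _) measurable_const)] at h1
    rw [h1]
    have : ∀ ω : ℕ → V, ∑' v, ENNReal.ofReal (transProb β G (ω t) v) *
        (if v = w then (1 : ℝ≥0∞) else 0) = ENNReal.ofReal (transProb β G (ω t) w) := fun ω => by
      rw [tsum_eq_single w fun v hv => by simp [hv]]
      simp
    simp_rw [this]
    rw [← lintegral_map (f := fun z => ENNReal.ofReal (transProb β G z w)) Measurable.of_discrete
      (measurable_pi_apply t), lintegral_countable']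
    refine tsum_congr fun z => ?_
    rw [Measure.map_apply (measurable_pi_apply t) (measurableSet_singleton _)]
    rfl
  have hfin : ∀ T w, ∑ t ∈ Finset.range T, μ {ω | ω t = w} ≤
      ENNReal.ofReal (vertWt β G w * h w) := by
    intro T
    induction T with
    | zero => simp
    | succ T ih =>
      intro w
      rw [Finset.sum_range_succ']
      simp_rw [hrec]
      rw [← Summable.tsum_finsetSum fun _ _ => ENNReal.summable]
      simp_rw [← Finset.mul_sum]
      have h0 : μ {ω | ω 0 = w} ≤ ENNReal.ofReal (if w = z₀ then 1 else 0) := by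
        split_ifs with hw
        · simpa using prob_le_one
        · rw [ENNReal.ofReal_zero, nonpos_iff_eq_zero]
          have := hμ.ae_start
          rw [ae_iff] at this
          refine measure_mono_null (fun ω hω => ?_) this
          simp only [Set.mem_ofPred_eq] at hω ⊢
          rwa [hω]
      have hs : ∑' z, ENNReal.ofReal (transProb β G z w) *
          ∑ t ∈ Finset.range T, μ {ω | ω t = z} ≤
          ENNReal.ofReal (∑ z ∈ latNbrs w, edgeWt β G w z * h z) := by
        calc _ ≤ ∑' z, ENNReal.ofReal (edgeWt β G w z * h z) := by
              refine ENNReal.tsum_le_tsum fun z => ?_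
              refine (mul_le_mul_right (ih z) _).trans ?_
              rw [← ENNReal.ofReal_mul (transProb_nonneg hβ hG _ _), edgeWt_comm,
                ← vertWt_mul_transProb hβ hG]
              exact le_of_eq (by ring_nf)
          _ = _ := by
              rw [tsum_eq_sum (s := latNbrs w), ← ENNReal.ofReal_sum_of_nonneg
                fun z _ => mul_nonneg (edgeWt_nonneg hβ _ _ _) (hh z)]
              intro z hz
              rw [edgeWt_eq_zero hG hz]
              simp
      refine (add_le_add hs h0).trans ?_
      rw [← ENNReal.ofReal_add (Finset.sum_nonneg fun z _ =>
        mul_nonneg (edgeWt_nonneg hβ _ _ _) (hh z)) (by split_ifs <;> norm_num)]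
      apply ENNReal.ofReal_le_ofReal
      rw [add_comm]
      exact hexc w
  exact ENNReal.tsum_le_of_sum_range_le fun T => hfin T w

/-- Maximal inequality for space-time supermartingales `u (ω t) / K ^ t`. -/
lemma IsWalkLaw.measure_hit_le {β : ℝ} (hβ : 1 < β) {G : Set (Sym2 V)} (hG : IsLatticeGraph G)
    {z₀ : V} {μ : Measure (ℕ → V)} (hμ : IsWalkLaw β G z₀ μ) {u : V → ℝ} {K a : ℝ}
    (hK : 1 ≤ K) (hu : ∀ z, 0 ≤ u z)
    (hsup : ∀ z, ∑ w ∈ latNbrs z, edgeWt β G z w * u w ≤ K * u z * vertWt β G z)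
    {A : Set V} (hA : ∀ z ∈ A, a ≤ u z) (T : ℕ) :
    ENNReal.ofReal a * μ {ω | ∃ s < T, ω s ∈ A} ≤ ENNReal.ofReal (K ^ T * u z₀) := by
  classical
  have hprob := hμ.1
  have hP : ∀ z, ∑' w, ENNReal.ofReal (transProb β G z w) * ENNReal.ofReal (u w) ≤
      ENNReal.ofReal (K * u z) := by
    intro z
    by_cases h : ∃ v, s(z, v) ∈ G
    · obtain ⟨v, hv⟩ := h
      exact tsum_transProb_mul_le hβ hG hv hu (hsup z)
    · push Not at h
      rw [tsum_eq_single z]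
      · rw [transProb_of_isolated h, if_pos rfl]
        rw [ENNReal.ofReal_one, one_mul]
        exact ENNReal.ofReal_le_ofReal (by nlinarith [hu z])
      · intro w hw
        rw [transProb_of_isolated h, if_neg hw]
        simp
  have hmu : ∀ t, Measurable fun ω : ℕ → V => ENNReal.ofReal (u (ω t)) := fun t =>
    (Measurable.of_discrete (f := fun z => ENNReal.ofReal (u z))).comp (measurable_pi_apply t)
  have hmA : ∀ t, MeasurableSet {ω : ℕ → V | ω t ∈ A} := fun t =>
    measurable_pi_apply t (MeasurableSet.of_discrete (s := A))
  have hmB : ∀ t, MeasurableSet {ω : ℕ → V | ∀ s < t, ω s ∉ A} := fun t => by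
    have : {ω : ℕ → V | ∀ s < t, ω s ∉ A} = ⋂ s, ⋂ (_ : s < t), {ω : ℕ → V | ω s ∈ A}ᶜ := by
      ext ω
      simp
    rw [this]
    exact MeasurableSet.iInter fun s => MeasurableSet.iInter fun _ => (hmA s).compl
  have key : ∀ T, ENNReal.ofReal a * μ {ω | ∃ s < T, ω s ∈ A} +
      ∫⁻ ω in {ω : ℕ → V | ∀ s < T, ω s ∉ A}, ENNReal.ofReal (u (ω T)) ∂μ ≤
      ENNReal.ofReal (K ^ T * u z₀) := by
    intro T
    induction T with
    | zero =>
      simp only [not_lt_zero, false_and, exists_false, Set.ofPred_false, measure_empty, mul_zero,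
        zero_add, false_imp_iff, implies_true, Set.ofPred_true, Measure.restrict_univ, pow_zero,
        one_mul]
      rw [lintegral_congr_ae (g := fun _ => ENNReal.ofReal (u z₀))]
      · simp
      · filter_upwards [hμ.ae_start] with ω hω
        rw [hω]
    | succ T ih =>
      have hstep : ∫⁻ ω in {ω : ℕ → V | ∀ s < T + 1, ω s ∉ A}, ENNReal.ofReal (u (ω (T + 1))) ∂μ ≤
          ENNReal.ofReal K * ∫⁻ ω in {ω : ℕ → V | ∀ s < T + 1, ω s ∉ A},
            ENNReal.ofReal (u (ω T)) ∂μ := by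
        have h := hμ.lintegral_succ hβ hG T (fun ω w =>
          Set.indicator {ω : ℕ → V | ∀ s < T + 1, ω s ∉ A} (fun _ => ENNReal.ofReal (u w)) ω)
          fun ω ω' hω => by
            have : ω ∈ {ω : ℕ → V | ∀ s < T + 1, ω s ∉ A} ↔
                ω' ∈ {ω : ℕ → V | ∀ s < T + 1, ω s ∉ A} := by
              simp only [Set.mem_ofPred_eq]
              refine forall_congr' fun s => imp_congr_right fun hs => ?_
              rw [hω s (by omega)]
            funext w
            simp only [Set.indicator_apply, this]
        rw [← lintegral_indicator (hmB _), ← lintegral_indicator (hmB _),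
          ← lintegral_const_mul' _ _ ENNReal.ofReal_ne_top]
        refine le_trans (le_of_eq ?_) ((le_of_eq h).trans ?_)
        · refine lintegral_congr fun ω => ?_
          simp only [Set.indicator_apply]
        · refine lintegral_mono fun ω => ?_
          simp only [Set.indicator_apply]
          split_ifs with hω
          · rw [← ENNReal.ofReal_mul (by linarith)]
            exact hP _
          · simp
      have hsplit : ENNReal.ofReal a * μ {ω | ∃ s < T + 1, ω s ∈ A} +
          ∫⁻ ω in {ω : ℕ → V | ∀ s < T + 1, ω s ∉ A}, ENNReal.ofReal (u (ω T)) ∂μ ≤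
          ENNReal.ofReal (K ^ T * u z₀) := by
        refine le_trans ?_ ih
        have e1 : {ω : ℕ → V | ∃ s < T + 1, ω s ∈ A} = {ω | ∃ s < T, ω s ∈ A} ∪
            ({ω : ℕ → V | ∀ s < T, ω s ∉ A} ∩ {ω | ω T ∈ A}) := by
          ext ω
          simp only [Set.mem_ofPred_eq, Set.mem_union, Set.mem_inter_iff]
          constructor
          · rintro ⟨s, hs, hsA⟩
            by_cases h : ∃ s < T, ω s ∈ A
            · exact Or.inl h
            · push Not at h
              refine Or.inr ⟨h, ?_⟩
              rcases Nat.lt_succ_iff_lt_or_eq.1 hs with h' | rfl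
              · exact absurd hsA (h s h')
              · exact hsA
          · rintro (⟨s, hs, hsA⟩ | ⟨_, h⟩)
            · exact ⟨s, by omega, hsA⟩
            · exact ⟨T, by omega, h⟩
        have e2 : {ω : ℕ → V | ∀ s < T + 1, ω s ∉ A} =
            {ω : ℕ → V | ∀ s < T, ω s ∉ A} \ {ω | ω T ∈ A} := by
          ext ω
          simp only [Set.mem_ofPred_eq, Set.mem_sdiff]
          constructor
          · exact fun h => ⟨fun s hs => h s (by omega), h T (by omega)⟩
          · rintro ⟨h1, h2⟩ s hs
            rcases Nat.lt_succ_iff_lt_or_eq.1 hs with h' | rfl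
            · exact h1 s h'
            · exact h2
        rw [e2, ← lintegral_inter_add_sdiff (μ := μ) (fun ω => ENNReal.ofReal (u (ω T)))
          {ω : ℕ → V | ∀ s < T, ω s ∉ A} (hmA T), ← add_assoc]
        gcongr
        rw [e1]
        refine (mul_le_mul_right (measure_union_le _ _) _).trans ?_
        rw [mul_add]
        gcongr
        rw [← setLIntegral_const]
        refine setLIntegral_mono (hmu T) fun ω hω => ?_
        exact ENNReal.ofReal_le_ofReal (hA _ hω.2)
      calc _ ≤ ENNReal.ofReal K * (ENNReal.ofReal a * μ {ω | ∃ s < T + 1, ω s ∈ A}) +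
            ENNReal.ofReal K * ∫⁻ ω in {ω : ℕ → V | ∀ s < T + 1, ω s ∉ A},
              ENNReal.ofReal (u (ω T)) ∂μ := by
            refine add_le_add ?_ hstep
            refine le_mul_of_one_le_left (zero_le) ?_
            rwa [ENNReal.one_le_ofReal]
        _ ≤ _ := by
            rw [← mul_add]
            refine (mul_le_mul_right hsplit _).trans ?_
            rw [← ENNReal.ofReal_mul (by linarith), pow_succ]
            exact le_of_eq (by ring_nf)
  exact le_self_add.trans (key T)

/-- A vertex whose neighbours are exactly its right and its left lattice neighbour. -/
def IsHorizontal (G : Set (Sym2 V)) (z : V) : Prop :=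
  s(z, ((z.1 + 1, z.2) : V)) ∈ G ∧ s(z, ((z.1 - 1, z.2) : V)) ∈ G ∧
    s(z, ((z.1, z.2 + 1) : V)) ∉ G ∧ s(z, ((z.1, z.2 - 1) : V)) ∉ G

lemma IsHorizontal.sum_edgeWt {β : ℝ} (hβ : 1 < β) {G : Set (Sym2 V)} {z : V} (hz : IsHorizontal G z)
    (f : V → ℝ) : ∑ w ∈ latNbrs z, edgeWt β G z w * f w =
      β ^ z.1 * (β * f (z.1 + 1, z.2) + f (z.1 - 1, z.2)) := by
  have hb : β ≠ 0 := by linarith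
  obtain ⟨h1, h2, h3, h4⟩ := hz
  rw [sum_latNbrs]
  simp only [edgeWt]
  rw [if_pos h1, if_pos h2, if_neg h3, if_neg h4]
  rw [max_eq_right (by simp), max_eq_left (by simp), zpow_add_one₀ hb]
  ring

open scoped Classical in
/-- The number of visits to vertices that are not horizontal before time `t`. -/
def irregCount (G : Set (Sym2 V)) (ω : ℕ → V) (t : ℕ) : ℝ :=
  ∑ s ∈ Finset.range t, if IsHorizontal G (ω s) then 0 else 1

lemma exp_le_one_add_add_sq {y : ℝ} (hy : |y| ≤ 1) : Real.exp y ≤ 1 + y + y ^ 2 := by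
  have := (abs_le.1 (Real.abs_exp_sub_one_sub_id_le hy)).2
  linarith

/-- One-step exponential moment bound for the compensated horizontal displacement. -/
lemma sum_edgeWt_exp_le {β : ℝ} (hβ : 1 < β) (G : Set (Sym2 V)) (z : V) {l σ k : ℝ}
    (hl : 0 < l) (hl2 : l ≤ 1 / 2) (hσ : |σ| = 1) (hk : k = 0 ∧ IsHorizontal G z ∨ k = 1) :
    ∑ w ∈ latNbrs z, edgeWt β G z w *
      Real.exp (l * (σ * ((w.1 : ℝ) - z.1 - (β - 1) / (β + 1)) - 2 * k) - 4 * l ^ 2) ≤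
      vertWt β G z := by
  have hb : 0 < β := by linarith
  set v := (β - 1) / (β + 1) with hv
  have hv0 : 0 ≤ v := div_nonneg (by linarith) (by linarith)
  have hv1 : v ≤ 1 := (div_le_one (by linarith)).2 (by linarith)
  have hve : β * (1 - v) = 1 + v := by
    rw [hv]
    field_simp
    ring
  have hy : ∀ d : ℝ, |d| ≤ 1 → |σ * (d - v)| ≤ 2 := fun d hd => by
    rw [abs_mul, hσ, one_mul]
    have := abs_le.1 hd
    rw [abs_le]
    constructor <;> linarith
  rcases hk with ⟨rfl, hz⟩ | rfl
  · have hvw : vertWt β G z = β ^ z.1 * (β + 1) := by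
      have := hz.sum_edgeWt hβ fun _ => 1
      simpa [vertWt] using this
    rw [hz.sum_edgeWt hβ, hvw]
    simp only
    have hx : (0 : ℝ) < β ^ z.1 := by positivity
    refine mul_le_mul_of_nonneg_left ?_ hx.le
    push_cast
    have key : ∀ d : ℝ, |d| ≤ 1 → Real.exp (l * (σ * (d - v)) - 4 * l ^ 2) ≤
        (1 + l * (σ * (d - v)) + 4 * l ^ 2) * Real.exp (-(4 * l ^ 2)) := fun d hd => by
      rw [sub_eq_add_neg, Real.exp_add]
      refine mul_le_mul_of_nonneg_right ?_ (Real.exp_pos _).le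
      have h2 := hy d hd
      have h3 : |l * (σ * (d - v))| ≤ 1 := by
        rw [abs_mul, abs_of_pos hl]
        nlinarith
      refine (exp_le_one_add_add_sq h3).trans ?_
      have h4 : (σ * (d - v)) ^ 2 ≤ 4 := by
        rw [← sq_abs]
        nlinarith [abs_nonneg (σ * (d - v))]
      nlinarith [sq_nonneg l]
    have k1 := key 1 (by simp)
    have k2 := key (-1) (by simp)
    have hE : (1 + 4 * l ^ 2) * Real.exp (-(4 * l ^ 2)) ≤ 1 := by
      rw [Real.exp_neg, ← div_eq_mul_inv, div_le_one (Real.exp_pos _), add_comm]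
      exact Real.add_one_le_exp _
    calc _ = β * Real.exp (l * (σ * (1 - v)) - 4 * l ^ 2) +
          Real.exp (l * (σ * (-1 - v)) - 4 * l ^ 2) := by
          congr 3 <;> ring_nf
      _ ≤ β * ((1 + l * (σ * (1 - v)) + 4 * l ^ 2) * Real.exp (-(4 * l ^ 2))) +
          (1 + l * (σ * (-1 - v)) + 4 * l ^ 2) * Real.exp (-(4 * l ^ 2)) := by gcongr
      _ = ((β + 1) * (1 + 4 * l ^ 2) + l * σ * (β * (1 - v) - (1 + v))) *
          Real.exp (-(4 * l ^ 2)) := by ring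
      _ = (β + 1) * ((1 + 4 * l ^ 2) * Real.exp (-(4 * l ^ 2))) := by rw [hve]; ring
      _ ≤ β + 1 := by nlinarith
  · refine Finset.sum_le_sum fun w hw => ?_
    refine mul_le_of_le_one_right (edgeWt_nonneg hβ _ _ _) ?_
    rw [Real.exp_le_one_iff]
    have h1 := latNbrs_fst hw
    have h2 : |(w.1 : ℝ) - z.1| ≤ 1 := by
      rw [abs_le]
      constructor
      · have : (z.1 : ℝ) - 1 ≤ w.1 := by exact_mod_cast h1.1
        linarith
      · have : (w.1 : ℝ) ≤ z.1 + 1 := by exact_mod_cast h1.2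
        linarith
    have := (abs_le.1 (hy _ h2)).2
    nlinarith [sq_nonneg l]

/-- Up to visits to vertices that are not horizontal, the walk has speed `(β - 1) / (β + 1)`. -/
lemma IsWalkLaw.ae_eventually_deviation_le {β : ℝ} (hβ : 1 < β) {G : Set (Sym2 V)}
    (hG : IsLatticeGraph G) {u : V} (hu : s(((0, 0) : V), u) ∈ G) {μ : Measure (ℕ → V)}
    (hμ : IsWalkLaw β G (0, 0) μ) {σ : ℝ} (hσ : |σ| = 1) {ε : ℝ} (hε : 0 < ε) :
    ∀ᵐ ω ∂μ, ∀ᶠ t : ℕ in atTop,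
      σ * ((ω t).1 - (β - 1) / (β + 1) * t) - 2 * irregCount G ω t ≤ ε * t := by
  classical
  have hprob := hμ.1
  set v := (β - 1) / (β + 1) with hv
  obtain ⟨l, hl, hl2, hlε⟩ : ∃ l : ℝ, 0 < l ∧ l ≤ 1 / 2 ∧ 8 * l ≤ ε :=
    ⟨min (1 / 2) (ε / 8), by positivity, min_le_left _ _, by
      linarith [min_le_right (1 / 2) (ε / 8)]⟩
  let S : ℕ → (ℕ → V) → ℝ := fun t ω =>
    Real.exp (l * (σ * ((ω t).1 - v * t) - 2 * irregCount G ω t) - 4 * l ^ 2 * t)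
  have hcongr : ∀ t (ω ω' : ℕ → V), (∀ i ≤ t, ω i = ω' i) →
      irregCount G ω (t + 1) = irregCount G ω' (t + 1) := fun t ω ω' h => by
    refine Finset.sum_congr rfl fun s hs => ?_
    rw [h s (by have := Finset.mem_range.1 hs; omega)]
  have hE : ∀ t, ∫⁻ ω, ENNReal.ofReal (S t ω) ∂μ ≤ 1 := by
    intro t
    induction t with
    | zero =>
      rw [lintegral_congr_ae (g := fun _ => 1)]
      · simp
      · filter_upwards [hμ.ae_start] with ω hω
        simp [S, hω, irregCount]
    | succ t ih =>
      refine le_trans ?_ ih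
      have h := hμ.lintegral_succ hβ hG t (fun ω w => ENNReal.ofReal
        (Real.exp (l * (σ * (w.1 - v * ((t + 1 : ℕ) : ℝ)) - 2 * irregCount G ω (t + 1)) -
          4 * l ^ 2 * ((t + 1 : ℕ) : ℝ)))) fun ω ω' hω => by
            simp only [hcongr t ω ω' hω]
      simp only [S]
      rw [h]
      refine lintegral_mono_ae ?_
      filter_upwards [hμ.ae_path hβ hG hu] with ω hω
      refine tsum_transProb_mul_le hβ hG (hω t) (fun w => (Real.exp_pos _).le) ?_
      have hk : (if IsHorizontal G (ω t) then (0 : ℝ) else 1) = 0 ∧ IsHorizontal G (ω t) ∨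
          (if IsHorizontal G (ω t) then (0 : ℝ) else 1) = 1 := by
        split_ifs with hr
        · exact Or.inl ⟨rfl, hr⟩
        · exact Or.inr rfl
      refine le_trans (le_of_eq ?_)
        (mul_le_mul_of_nonneg_left (sum_edgeWt_exp_le hβ G (ω t) hl hl2 hσ hk)
          (Real.exp_pos (l * (σ * ((ω t).1 - v * t) - 2 * irregCount G ω t) - 4 * l ^ 2 * t)).le)
      rw [Finset.mul_sum]
      refine Finset.sum_congr rfl fun w _ => ?_
      rw [mul_left_comm, ← Real.exp_add, irregCount, Finset.sum_range_succ, ← irregCount]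
      congr 2
      push_cast
      ring
  have hm : ∀ t, Measurable (S t) := by
    intro t
    have h1 : Measurable fun ω : ℕ → V => (((ω t).1 : ℤ) : ℝ) :=
      (Measurable.of_discrete (f := fun z : V => ((z.1 : ℤ) : ℝ))).comp (measurable_pi_apply t)
    have h2 : Measurable fun ω : ℕ → V => irregCount G ω t := by
      unfold irregCount
      exact Finset.measurable_sum _ fun s _ =>
        (Measurable.of_discrete (f := fun z : V => if IsHorizontal G z then (0 : ℝ) else 1)).comp
          (measurable_pi_apply s)
    fun_prop
  let c := 4 * l ^ 2
  have hc : 0 < c := by positivity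
  have hbad : ∀ t : ℕ, μ {ω | ¬ (σ * ((ω t).1 - v * t) - 2 * irregCount G ω t ≤ ε * t)} ≤
      ENNReal.ofReal (Real.exp (-c) ^ t) := by
    intro t
    have hsub : {ω : ℕ → V | ¬ (σ * ((ω t).1 - v * t) - 2 * irregCount G ω t ≤ ε * t)} ⊆
        {ω | ENNReal.ofReal (Real.exp (c * t)) ≤ ENNReal.ofReal (S t ω)} := by
      intro ω hω
      simp only [Set.mem_ofPred_eq, not_le] at hω ⊢
      apply ENNReal.ofReal_le_ofReal
      apply Real.exp_le_exp.2
      have ht : (0 : ℝ) ≤ t := Nat.cast_nonneg t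
      have h1 : l * (ε * t) ≤ l * (σ * ((ω t).1 - v * t) - 2 * irregCount G ω t) :=
        mul_le_mul_of_nonneg_left hω.le hl.le
      have h2 : l * (8 * l * t) ≤ l * (ε * t) := by gcongr
      simp only [c]
      nlinarith
    refine (measure_mono hsub).trans ?_
    have h1 := mul_meas_ge_le_lintegral (μ := μ) (hm t).ennreal_ofReal
      (ENNReal.ofReal (Real.exp (c * t)))
    have h2 := h1.trans (hE t)
    rw [← Real.exp_nat_mul, mul_neg, Real.exp_neg, ENNReal.ofReal_inv_of_pos (Real.exp_pos _),
      ENNReal.le_inv_iff_mul_le, mul_comm, mul_comm (t : ℝ)]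
    exact h2
  have hsum : ∑' t : ℕ, μ {ω | ¬ (σ * ((ω t).1 - v * t) - 2 * irregCount G ω t ≤ ε * t)} ≠ ⊤ := by
    refine ne_top_of_le_ne_top ?_ (ENNReal.tsum_le_tsum hbad)
    rw [← ENNReal.ofReal_tsum_of_nonneg (fun t => by positivity)
      (summable_geometric_of_lt_one (Real.exp_pos _).le (by
        rw [Real.exp_lt_one_iff]; linarith))]
    exact ENNReal.ofReal_ne_top
  filter_upwards [ae_eventually_notMem hsum] with ω hω
  filter_upwards [hω] with t ht
  simpa using ht

lemma IsWalkLaw.ae_tendsto_speed {β : ℝ} (hβ : 1 < β) {G : Set (Sym2 V)}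
    (hG : IsLatticeGraph G) {u : V} (hu : s(((0, 0) : V), u) ∈ G) {μ : Measure (ℕ → V)}
    (hμ : IsWalkLaw β G (0, 0) μ)
    (hN : ∀ᵐ ω ∂μ, Tendsto (fun t : ℕ => irregCount G ω t / t) atTop (nhds 0)) :
    ∀ᵐ ω ∂μ, Tendsto (fun t : ℕ => ((ω t).1 : ℝ) / t) atTop (nhds ((β - 1) / (β + 1))) := by
  have h1 : ∀ᵐ ω ∂μ, ∀ k : ℕ, ∀ᶠ t : ℕ in atTop,
      1 * ((ω t).1 - (β - 1) / (β + 1) * t) - 2 * irregCount G ω t ≤ 1 / ((k : ℝ) + 1) * t :=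
    ae_all_iff.2 fun k => hμ.ae_eventually_deviation_le hβ hG hu (by simp) (by positivity)
  have h2 : ∀ᵐ ω ∂μ, ∀ k : ℕ, ∀ᶠ t : ℕ in atTop,
      (-1) * ((ω t).1 - (β - 1) / (β + 1) * t) - 2 * irregCount G ω t ≤ 1 / ((k : ℝ) + 1) * t :=
    ae_all_iff.2 fun k => hμ.ae_eventually_deviation_le hβ hG hu (by simp) (by positivity)
  filter_upwards [h1, h2, hN] with ω h1 h2 hN
  rw [Metric.tendsto_atTop'] at hN ⊢
  intro ε hε
  obtain ⟨k, hk⟩ := exists_nat_one_div_lt (half_pos hε)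
  obtain ⟨N, hN⟩ := hN (ε / 4) (by positivity)
  obtain ⟨N1, hN1⟩ := eventually_atTop.1 (h1 k)
  obtain ⟨N2, hN2⟩ := eventually_atTop.1 (h2 k)
  refine ⟨max N (max N1 N2), fun t ht => ?_⟩
  have ht0 : (0 : ℝ) < t := by
    have : 0 < t := by omega
    exact_mod_cast this
  have a1 := hN t (by omega)
  have a2 := hN1 t (by omega)
  have a3 := hN2 t (by omega)
  rw [Real.dist_eq, sub_zero] at a1
  have a4 := (abs_lt.1 a1).2
  rw [div_lt_iff₀ ht0] at a4
  have a5 : 1 / ((k : ℝ) + 1) * t < ε / 2 * t := mul_lt_mul_of_pos_right hk ht0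
  rw [Real.dist_eq, div_sub' ht0.ne', abs_div, abs_of_pos ht0, div_lt_iff₀ ht0, abs_lt]
  constructor <;> linarith

/-- Kronecker-type lemma. -/
lemma tendsto_sum_div_of_le_mul {f a : ℕ → ℝ} (hf : ∀ t, 0 ≤ f t) (ha : Summable a)
    (ha0 : ∀ t, 0 ≤ a t) (hfa : ∀ t, f t ≤ a t * (t + 1)) :
    Tendsto (fun T : ℕ => (∑ t ∈ Finset.range T, f t) / T) atTop (nhds 0) := by
  have key : Tendsto (fun T : ℕ => ∑' t : ℕ, if t < T then a t * ((t + 1) / T) else 0) atTop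
      (nhds (∑' _ : ℕ, (0 : ℝ))) := by
    refine tendsto_tsum_of_dominated_convergence ha (fun t => ?_) ?_
    · have h1 : Tendsto (fun T : ℕ => a t * (((t : ℝ) + 1) / T)) atTop (nhds (a t * 0)) :=
        (tendsto_const_div_atTop_nhds_zero_nat _).const_mul _
      rw [mul_zero] at h1
      refine h1.congr' ?_
      filter_upwards [eventually_gt_atTop t] with T hT
      rw [if_pos hT]
    · refine Eventually.of_forall fun T t => ?_
      split_ifs with h
      · have hT : (0 : ℝ) < T := by
          have : 0 < T := by omega
          exact_mod_cast this
        have h2 : ((t : ℝ) + 1) / T ≤ 1 := by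
          rw [div_le_one hT]
          exact_mod_cast h
        have h3 : 0 ≤ ((t : ℝ) + 1) / T := by positivity
        rw [Real.norm_of_nonneg (mul_nonneg (ha0 t) h3)]
        exact mul_le_of_le_one_right (ha0 t) h2
      · simpa using ha0 t
  rw [tsum_zero] at key
  refine squeeze_zero (fun T => div_nonneg (Finset.sum_nonneg fun t _ => hf t)
    (Nat.cast_nonneg T)) (fun T => ?_) key
  rw [tsum_eq_sum (s := Finset.range T)]
  · rw [Finset.sum_div]
    refine Finset.sum_le_sum fun t ht => ?_
    rw [if_pos (Finset.mem_range.1 ht), ← mul_div_assoc]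
    exact div_le_div_of_nonneg_right (hfa t) (Nat.cast_nonneg T)
  · intro t ht
    rw [if_neg (by simpa using ht)]

/-- The leftmost abscissa of the `n`-th trap. -/
def aWarm (α : ℝ) (n : ℕ) : ℤ := dWarm n - eWarm α n

lemma aWarm_le (α : ℝ) (n : ℕ) : aWarm α n ≤ dWarm n := by
  unfold aWarm
  omega

lemma one_le_dWarm {n : ℕ} (hn : 1 ≤ n) : 1 ≤ dWarm n := by
  have : (1 : ℤ) ≤ n := by exact_mod_cast hn
  exact one_le_pow₀ this

lemma WarmupSeparated.disjoint {α : ℝ} {n₀ : ℕ} (hsep : WarmupSeparated α n₀) {m n : ℕ}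
    (hm : n₀ ≤ m) (hn : n₀ ≤ n) : m = n ∨ (dWarm m < aWarm α n ∧ aWarm α m + m < aWarm α n) ∨
      (dWarm n < aWarm α m ∧ aWarm α n + n < aWarm α m) := by
  rcases lt_trichotomy m n with h | h | h
  · exact Or.inr (Or.inl (hsep m n hm h))
  · exact Or.inl h
  · exact Or.inr (Or.inr (hsep n m hn h))

lemma horizontal_mem_warmupEdges {α : ℝ} {n₀ : ℕ} {x y : ℤ} :
    s(((x, y) : V), (x + 1, y)) ∈ warmupEdges α n₀ ↔ (y = 0 ∧ 0 ≤ x) ∨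
      (y = 1 ∧ ∃ n, n₀ ≤ n ∧ aWarm α n ≤ x ∧ x < dWarm n) ∨
      (y = 2 ∧ ∃ n, n₀ ≤ n ∧ aWarm α n ≤ x ∧ x < aWarm α n + n) := by
  simp only [warmupEdges, trapEdgesAt, cWarm, aWarm, Set.mem_union, Set.mem_iUnion,
    Set.mem_ofPred_eq, Set.mem_insert_iff, Set.mem_singleton_iff, Sym2.eq_iff, Prod.mk.injEq,
    exists_prop]
  constructor
  · rintro (⟨k, h⟩ | ⟨n, hn, ((h | h) | ⟨i, hi, h⟩) | ⟨i, hi, h⟩⟩)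
    · exact Or.inl (by omega)
    · omega
    · omega
    · exact Or.inr (Or.inl ⟨by omega, n, hn, by omega, by omega⟩)
    · exact Or.inr (Or.inr ⟨by omega, n, hn, by omega, by omega⟩)
  · rintro (⟨rfl, h⟩ | ⟨rfl, n, hn, h1, h2⟩ | ⟨rfl, n, hn, h1, h2⟩)
    · exact Or.inl ⟨x.toNat, by omega⟩
    · exact Or.inr ⟨n, hn, Or.inl (Or.inr ⟨(x - (dWarm n - eWarm α n)).toNat, by omega, by omega⟩)⟩
    · exact Or.inr ⟨n, hn, Or.inr ⟨(x - (dWarm n - eWarm α n)).toNat, by omega, by omega⟩⟩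

lemma vertical_mem_warmupEdges {α : ℝ} {n₀ : ℕ} {x y : ℤ} :
    s(((x, y) : V), (x, y + 1)) ∈ warmupEdges α n₀ ↔
      (y = 0 ∧ ∃ n, n₀ ≤ n ∧ x = dWarm n) ∨ (y = 1 ∧ ∃ n, n₀ ≤ n ∧ x = aWarm α n) := by
  simp only [warmupEdges, trapEdgesAt, cWarm, aWarm, Set.mem_union, Set.mem_iUnion,
    Set.mem_ofPred_eq, Set.mem_insert_iff, Set.mem_singleton_iff, Sym2.eq_iff, Prod.mk.injEq,
    exists_prop]
  constructor
  · rintro (⟨k, h⟩ | ⟨n, hn, ((h | h) | ⟨i, hi, h⟩) | ⟨i, hi, h⟩⟩)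
    · omega
    · exact Or.inl ⟨by omega, n, hn, by omega⟩
    · exact Or.inr ⟨by omega, n, hn, by omega⟩
    · omega
    · omega
  · rintro (⟨rfl, n, hn, h⟩ | ⟨rfl, n, hn, h⟩)
    · exact Or.inr ⟨n, hn, Or.inl (Or.inl (Or.inl (by omega)))⟩
    · exact Or.inr ⟨n, hn, Or.inl (Or.inl (Or.inr (by omega)))⟩

lemma left_mem_warmupEdges {α : ℝ} {n₀ : ℕ} {x y : ℤ} :
    s(((x, y) : V), (x - 1, y)) ∈ warmupEdges α n₀ ↔
      s(((x - 1, y) : V), (x - 1 + 1, y)) ∈ warmupEdges α n₀ := by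
  rw [Sym2.eq_swap, sub_add_cancel]

lemma down_mem_warmupEdges {α : ℝ} {n₀ : ℕ} {x y : ℤ} :
    s(((x, y) : V), (x, y - 1)) ∈ warmupEdges α n₀ ↔
      s(((x, y - 1) : V), (x, y - 1 + 1)) ∈ warmupEdges α n₀ := by
  rw [Sym2.eq_swap, sub_add_cancel]

lemma isLatticeGraph_warmupEdges (α : ℝ) (n₀ : ℕ) : IsLatticeGraph (warmupEdges α n₀) := by
  rintro ⟨x, y⟩ ⟨x', y'⟩ h
  simp only [warmupEdges, trapEdgesAt, cWarm, Set.mem_union, Set.mem_iUnion,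
    Set.mem_ofPred_eq, Set.mem_insert_iff, Set.mem_singleton_iff, Sym2.eq_iff, Prod.mk.injEq,
    exists_prop] at h
  simp only [latNbrs, Finset.mem_insert, Finset.mem_singleton, Prod.mk.injEq]
  rcases h with ⟨k, h⟩ | ⟨n, hn, ((h | h) | ⟨i, hi, h⟩) | ⟨i, hi, h⟩⟩ <;> omega

/-- The location of the non-isolated vertices. -/
def InWarmup (α : ℝ) (n₀ : ℕ) (z : V) : Prop :=
  (z.2 = 0 ∧ 0 ≤ z.1) ∨ (∃ n, n₀ ≤ n ∧ z.2 = 1 ∧ aWarm α n ≤ z.1 ∧ z.1 ≤ dWarm n) ∨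
    (∃ n, n₀ ≤ n ∧ z.2 = 2 ∧ aWarm α n ≤ z.1 ∧ z.1 ≤ aWarm α n + n)

lemma inWarmup_of_mem {α : ℝ} {n₀ : ℕ} {z w : V} (hn₀ : 1 ≤ n₀)
    (h : s(z, w) ∈ warmupEdges α n₀) : InWarmup α n₀ z := by
  have hw := isLatticeGraph_warmupEdges α n₀ z w h
  obtain ⟨x, y⟩ := z
  simp only [latNbrs, Finset.mem_insert, Finset.mem_singleton] at hw
  unfold InWarmup
  simp only
  rcases hw with rfl | rfl | rfl | rfl
  · rcases horizontal_mem_warmupEdges.1 h with h | ⟨h, n, hn, h1, h2⟩ | ⟨h, n, hn, h1, h2⟩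
    · exact Or.inl h
    · exact Or.inr (Or.inl ⟨n, hn, h, h1, h2.le⟩)
    · exact Or.inr (Or.inr ⟨n, hn, h, h1, h2.le⟩)
  · rw [left_mem_warmupEdges] at h
    rcases horizontal_mem_warmupEdges.1 h with h | ⟨h, n, hn, h1, h2⟩ | ⟨h, n, hn, h1, h2⟩
    · exact Or.inl (by omega)
    · exact Or.inr (Or.inl ⟨n, hn, h, by omega, by omega⟩)
    · exact Or.inr (Or.inr ⟨n, hn, h, by omega, by omega⟩)
  · rcases vertical_mem_warmupEdges.1 h with ⟨h, n, hn, h1⟩ | ⟨h, n, hn, h1⟩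
    · have := one_le_dWarm (hn₀.trans hn)
      exact Or.inl (by omega)
    · have := aWarm_le α n
      exact Or.inr (Or.inl ⟨n, hn, h, by omega, by omega⟩)
  · rw [down_mem_warmupEdges] at h
    rcases vertical_mem_warmupEdges.1 h with ⟨h, n, hn, h1⟩ | ⟨h, n, hn, h1⟩
    · have := aWarm_le α n
      exact Or.inr (Or.inl ⟨n, hn, by omega, by omega, by omega⟩)
    · exact Or.inr (Or.inr ⟨n, hn, by omega, by omega, by omega⟩)

lemma irregular_cases {α : ℝ} {n₀ : ℕ} {z : V} (hz : InWarmup α n₀ z) (hreg : ¬ IsHorizontal (warmupEdges α n₀) z) :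
    z = (0, 0) ∨ ∃ n, n₀ ≤ n ∧ (z = (dWarm n, 0) ∨ z = (dWarm n, 1) ∨ z = (aWarm α n, 1) ∨
      z = (aWarm α n, 2) ∨ z = (aWarm α n + n, 2)) := by
  obtain ⟨x, y⟩ := z
  simp only [IsHorizontal, left_mem_warmupEdges, down_mem_warmupEdges,
    horizontal_mem_warmupEdges, vertical_mem_warmupEdges] at hreg
  simp only [InWarmup] at hz
  simp only [Prod.mk.injEq]
  by_contra hc
  push Not at hc
  obtain ⟨hc0, hc⟩ := hc
  refine hreg ⟨?_, ?_, ?_, ?_⟩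
  · rcases hz with hz | ⟨n, hn, hy, h1, h2⟩ | ⟨n, hn, hy, h1, h2⟩
    · exact Or.inl hz
    · have := hc n hn
      exact Or.inr (Or.inl ⟨hy, n, hn, by omega, by omega⟩)
    · have := hc n hn
      exact Or.inr (Or.inr ⟨hy, n, hn, by omega, by omega⟩)
  · rcases hz with hz | ⟨n, hn, hy, h1, h2⟩ | ⟨n, hn, hy, h1, h2⟩
    · exact Or.inl (by omega)
    · have := hc n hn
      exact Or.inr (Or.inl ⟨hy, n, hn, by omega, by omega⟩)
    · have := hc n hn
      exact Or.inr (Or.inr ⟨hy, n, hn, by omega, by omega⟩)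
  · rintro (⟨hy, n, hn, h⟩ | ⟨hy, n, hn, h⟩) <;>
    · have := hc n hn
      omega
  · rintro (⟨hy, n, hn, h⟩ | ⟨hy, n, hn, h⟩) <;>
    · have := hc n hn
      omega

open scoped Classical in
/-- The index of the trap above the abscissa `x` (junk if there is none). -/
def trapIdx (α : ℝ) (n₀ : ℕ) (x : ℤ) : ℕ :=
  if h : ∃ n, n₀ ≤ n ∧ aWarm α n ≤ x ∧ (x ≤ dWarm n ∨ x ≤ aWarm α n + n) then h.choose else 0

lemma trapIdx_eq {α : ℝ} {n₀ : ℕ} (hsep : WarmupSeparated α n₀) {x : ℤ} {n : ℕ} (hn : n₀ ≤ n)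
    (h1 : aWarm α n ≤ x) (h2 : x ≤ dWarm n ∨ x ≤ aWarm α n + n) : trapIdx α n₀ x = n := by
  have h : ∃ n, n₀ ≤ n ∧ aWarm α n ≤ x ∧ (x ≤ dWarm n ∨ x ≤ aWarm α n + n) := ⟨n, hn, h1, h2⟩
  rw [trapIdx, dif_pos h]
  obtain ⟨hm, h3, h4⟩ := h.choose_spec
  have := hsep.disjoint hm hn
  omega

open scoped Classical in
/-- The projection of a vertex to the backbone: traps are collapsed onto their anchors. -/
def backbone (α : ℝ) (n₀ : ℕ) (z : V) : ℤ :=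
  if z.2 = 0 then z.1 else dWarm (trapIdx α n₀ z.1)

lemma backbone_zero (α : ℝ) (n₀ : ℕ) (x : ℤ) : backbone α n₀ (x, 0) = x := if_pos rfl

lemma backbone_trap {α : ℝ} {n₀ : ℕ} (hsep : WarmupSeparated α n₀) {x y : ℤ} {n : ℕ} (hy : y ≠ 0)
    (hn : n₀ ≤ n) (h1 : aWarm α n ≤ x) (h2 : x ≤ dWarm n ∨ x ≤ aWarm α n + n) :
    backbone α n₀ (x, y) = dWarm n := by
  rw [backbone, if_neg hy, trapIdx_eq hsep hn h1 h2]

lemma backbone_horizontal {α : ℝ} {n₀ : ℕ} (hsep : WarmupSeparated α n₀) {x y : ℤ} (hy : y ≠ 0)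
    (h : s(((x, y) : V), (x + 1, y)) ∈ warmupEdges α n₀) :
    backbone α n₀ (x + 1, y) = backbone α n₀ (x, y) := by
  rcases horizontal_mem_warmupEdges.1 h with h | ⟨_, n, hn, h1, h2⟩ | ⟨_, n, hn, h1, h2⟩
  · exact absurd h.1 hy
  all_goals
    rw [backbone_trap hsep hy hn (by omega) (by omega),
      backbone_trap hsep hy hn (by omega) (by omega)]

lemma backbone_vertical {α : ℝ} {n₀ : ℕ} (hsep : WarmupSeparated α n₀) {x y : ℤ}
    (h : s(((x, y) : V), (x, y + 1)) ∈ warmupEdges α n₀) :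
    backbone α n₀ (x, y + 1) = backbone α n₀ (x, y) := by
  rcases vertical_mem_warmupEdges.1 h with ⟨rfl, n, hn, rfl⟩ | ⟨rfl, n, hn, rfl⟩
  · rw [backbone_trap hsep (by omega) hn (aWarm_le α n) (by omega), backbone_zero]
  · have := aWarm_le α n
    rw [backbone_trap hsep (by omega) hn (by omega) (by omega),
      backbone_trap hsep (by omega) hn (by omega) (by omega)]

/-- The net flow of the gradient of `f` into `z`: the unnormalised generator. -/
def netFlow (β : ℝ) (G : Set (Sym2 V)) (f : V → ℝ) (z : V) : ℝ :=
  ∑ w ∈ latNbrs z, edgeWt β G z w * (f w - f z)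

lemma sum_edgeWt_mul (β : ℝ) (G : Set (Sym2 V)) (f : V → ℝ) (z : V) :
    ∑ w ∈ latNbrs z, edgeWt β G z w * f w = netFlow β G f z + vertWt β G z * f z := by
  simp only [netFlow, vertWt, mul_sub, Finset.sum_sub_distrib, Finset.sum_mul]
  ring

open scoped Classical in
lemma netFlow_warmup (β α : ℝ) (n₀ : ℕ) (f : V → ℝ) (x y : ℤ) :
    netFlow β (warmupEdges α n₀) f (x, y) =
      (if s(((x, y) : V), (x + 1, y)) ∈ warmupEdges α n₀ then
        β ^ (x + 1) * (f (x + 1, y) - f (x, y)) else 0) +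
      (if s(((x - 1, y) : V), (x - 1 + 1, y)) ∈ warmupEdges α n₀ then
        β ^ x * (f (x - 1, y) - f (x, y)) else 0) +
      (if s(((x, y) : V), (x, y + 1)) ∈ warmupEdges α n₀ then
        β ^ x * (f (x, y + 1) - f (x, y)) else 0) +
      (if s(((x, y - 1) : V), (x, y - 1 + 1)) ∈ warmupEdges α n₀ then
        β ^ x * (f (x, y - 1) - f (x, y)) else 0) := by
  rw [netFlow, sum_latNbrs]
  simp only [edgeWt, left_mem_warmupEdges, down_mem_warmupEdges, ite_mul, zero_mul]
  rw [max_eq_right (by simp), max_eq_left (by simp), max_self]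

lemma netFlow_backbone {β α : ℝ} {n₀ : ℕ} (hsep : WarmupSeparated α n₀) (g : ℤ → ℝ) (x y : ℤ) :
    netFlow β (warmupEdges α n₀) (fun z => g (backbone α n₀ z)) (x, y) =
      if y = 0 ∧ 0 ≤ x then
        β ^ (x + 1) * (g (x + 1) - g x) + (if 1 ≤ x then β ^ x * (g (x - 1) - g x) else 0)
      else 0 := by
  classical
  have t3 : (if s(((x, y) : V), (x, y + 1)) ∈ warmupEdges α n₀ then
      β ^ x * (g (backbone α n₀ (x, y + 1)) - g (backbone α n₀ (x, y))) else 0) = 0 := by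
    split_ifs with h
    · rw [backbone_vertical hsep h]
      ring
    · rfl
  have t4 : (if s(((x, y - 1) : V), (x, y - 1 + 1)) ∈ warmupEdges α n₀ then
      β ^ x * (g (backbone α n₀ (x, y - 1)) - g (backbone α n₀ (x, y))) else 0) = 0 := by
    split_ifs with h
    · have := backbone_vertical hsep h
      rw [sub_add_cancel] at this
      rw [this]
      ring
    · rfl
  rw [netFlow_warmup, t3, t4]
  by_cases hy : y = 0
  · subst hy
    simp only [backbone_zero, horizontal_mem_warmupEdges, true_and]
    by_cases hx : 0 ≤ x
    · rw [if_pos (Or.inl hx), if_pos hx]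
      by_cases hx1 : 1 ≤ x
      · rw [if_pos (Or.inl (by omega)), if_pos hx1]
        ring
      · rw [if_neg (by omega), if_neg hx1]
        ring
    · rw [if_neg (by omega), if_neg (by omega), if_neg hx]
      ring
  · have t1 : (if s(((x, y) : V), (x + 1, y)) ∈ warmupEdges α n₀ then
        β ^ (x + 1) * (g (backbone α n₀ (x + 1, y)) - g (backbone α n₀ (x, y))) else 0) = 0 := by
      split_ifs with h
      · rw [backbone_horizontal hsep hy h]
        ring
      · rfl
    have t2 : (if s(((x - 1, y) : V), (x - 1 + 1, y)) ∈ warmupEdges α n₀ then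
        β ^ x * (g (backbone α n₀ (x - 1, y)) - g (backbone α n₀ (x, y))) else 0) = 0 := by
      split_ifs with h
      · have := backbone_horizontal hsep hy h
        rw [sub_add_cancel] at this
        rw [this]
        ring
      · rfl
    rw [t1, t2, if_neg (by tauto)]
    ring

open scoped Classical in
/-- The potential in the `n`-th trap of a current flowing from its anchor to the end of its
core. -/
def trapPotential (β α : ℝ) (n : ℕ) (z : V) : ℝ :=
  if z.2 = 1 ∧ aWarm α n ≤ z.1 ∧ z.1 ≤ dWarm n then β - 2 + β ^ (dWarm n - z.1)
  else if z.2 = 2 ∧ aWarm α n ≤ z.1 ∧ z.1 ≤ aWarm α n + n then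
    β - 2 + (β + 1) * β ^ eWarm α n - β ^ (dWarm n - z.1)
  else 0

lemma trapPotential_entrance {β α : ℝ} {n : ℕ} {x : ℤ} (h1 : aWarm α n ≤ x) (h2 : x ≤ dWarm n) :
    trapPotential β α n (x, 1) = β - 2 + β ^ (dWarm n - x) := if_pos ⟨rfl, h1, h2⟩

lemma trapPotential_core {β α : ℝ} {n : ℕ} {x : ℤ} (h1 : aWarm α n ≤ x)
    (h2 : x ≤ aWarm α n + n) : trapPotential β α n (x, 2) =
      β - 2 + (β + 1) * β ^ eWarm α n - β ^ (dWarm n - x) := by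
  rw [trapPotential, if_neg (by simp), if_pos ⟨rfl, h1, h2⟩]

lemma trapPotential_of_ne {β α : ℝ} {n : ℕ} {x y : ℤ} (h1 : y ≠ 1) (h2 : y ≠ 2) :
    trapPotential β α n (x, y) = 0 := by
  rw [trapPotential, if_neg (by tauto), if_neg (by tauto)]

lemma trapPotential_entrance_of_not {β α : ℝ} {n : ℕ} {x : ℤ}
    (h : ¬ (aWarm α n ≤ x ∧ x ≤ dWarm n)) : trapPotential β α n (x, 1) = 0 := by
  rw [trapPotential, if_neg (by tauto), if_neg (by simp)]

lemma trapPotential_core_of_not {β α : ℝ} {n : ℕ} {x : ℤ}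
    (h : ¬ (aWarm α n ≤ x ∧ x ≤ aWarm α n + n)) : trapPotential β α n (x, 2) = 0 := by
  rw [trapPotential, if_neg (by simp), if_neg (by tauto)]

lemma netFlow_trapPotential_entrance {β α : ℝ} (hβ : 1 < β) {n₀ : ℕ}
    (hsep : WarmupSeparated α n₀) {n : ℕ} (hn : n₀ ≤ n) (x : ℤ) :
    netFlow β (warmupEdges α n₀) (trapPotential β α n) (x, 1) = 0 := by
  classical
  have hb : β ≠ 0 := by linarith
  have hbx : ∀ y : ℤ, β ^ y ≠ 0 := fun y => zpow_ne_zero y hb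
  have had := aWarm_le α n
  rw [netFlow_warmup]
  simp only [horizontal_mem_warmupEdges, vertical_mem_warmupEdges]
  norm_num
  by_cases hx : aWarm α n ≤ x ∧ x ≤ dWarm n
  · obtain ⟨h1, h2⟩ := hx
    have c1 : (∃ m, n₀ ≤ m ∧ aWarm α m ≤ x ∧ x < dWarm m) ↔ x < dWarm n :=
      ⟨fun ⟨m, hm, h3, h4⟩ => by
        rcases hsep.disjoint hm hn with rfl | h | h <;> omega, fun h => ⟨n, hn, h1, h⟩⟩
    have c2 : (∃ m, n₀ ≤ m ∧ aWarm α m < x ∧ x ≤ dWarm m) ↔ aWarm α n < x :=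
      ⟨fun ⟨m, hm, h3, h4⟩ => by
        rcases hsep.disjoint hm hn with rfl | h | h <;> omega, fun h => ⟨n, hn, by omega, h2⟩⟩
    have c3 : (∃ m, n₀ ≤ m ∧ x = aWarm α m) ↔ x = aWarm α n :=
      ⟨fun ⟨m, hm, h3⟩ => by
        have := aWarm_le α m
        rcases hsep.disjoint hm hn with rfl | h | h <;> omega, fun h => ⟨n, hn, h⟩⟩
    have c4 : (∃ m, n₀ ≤ m ∧ x = dWarm m) ↔ x = dWarm n :=
      ⟨fun ⟨m, hm, h3⟩ => by
        have := aWarm_le α m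
        rcases hsep.disjoint hm hn with rfl | h | h <;> omega, fun h => ⟨n, hn, h⟩⟩
    rw [if_congr c1 rfl rfl, if_congr c2 rfl rfl, if_congr c3 rfl rfl, if_congr c4 rfl rfl,
      trapPotential_entrance h1 h2, trapPotential_of_ne (y := 0) (by omega) (by omega)]
    have t1 : (if x < dWarm n then β ^ (x + 1) * (trapPotential β α n (x + 1, 1) -
        (β - 2 + β ^ (dWarm n - x))) else 0) =
        if x < dWarm n then - (β ^ dWarm n * (β - 1)) else 0 := by
      split_ifs with h
      · rw [trapPotential_entrance (by omega) (by omega), zpow_add_one₀ hb,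
          show dWarm n - (x + 1) = dWarm n - x - 1 by ring, zpow_sub_one₀ hb, zpow_sub₀ hb]
        field_simp [hbx]
        ring
      · rfl
    have t2 : (if aWarm α n < x then β ^ x * (trapPotential β α n (x - 1, 1) -
        (β - 2 + β ^ (dWarm n - x))) else 0) =
        if aWarm α n < x then β ^ dWarm n * (β - 1) else 0 := by
      split_ifs with h
      · rw [trapPotential_entrance (by omega) (by omega),
          show dWarm n - (x - 1) = dWarm n - x + 1 by ring, zpow_add_one₀ hb, zpow_sub₀ hb]
        field_simp [hbx]
        ring
      · rfl
    have t3 : (if x = aWarm α n then β ^ x * (trapPotential β α n (x, 2) -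
        (β - 2 + β ^ (dWarm n - x))) else 0) =
        if x = aWarm α n then β ^ dWarm n * (β - 1) else 0 := by
      split_ifs with h
      · have he : β ^ eWarm α n = β ^ (dWarm n - x) := by
          rw [← zpow_natCast, h, aWarm]
          congr 1
          ring
        rw [trapPotential_core (by omega) (by omega), he, zpow_sub₀ hb]
        field_simp [hbx]
        ring
      · rfl
    have t4 : (if x = dWarm n then β ^ x * (0 - (β - 2 + β ^ (dWarm n - x))) else 0) =
        if x = dWarm n then - (β ^ dWarm n * (β - 1)) else 0 := by
      split_ifs with h
      · rw [h, sub_self, zpow_zero]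
        ring
      · rfl
    rw [t1, t2, t3, t4]
    by_cases e1 : x = aWarm α n <;> by_cases e2 : x = dWarm n
    · rw [if_neg (by omega), if_neg (by omega), if_pos e1, if_pos e2]
      ring
    · rw [if_pos (by omega), if_neg (by omega), if_pos e1, if_neg e2]
      ring
    · rw [if_neg (by omega), if_pos (by omega), if_neg e1, if_pos e2]
      ring
    · rw [if_pos (by omega), if_pos (by omega), if_neg e1, if_neg e2]
      ring
  · rw [trapPotential_entrance_of_not hx, trapPotential_of_ne (y := 0) (by omega) (by omega)]
    have t1 : (∃ m, n₀ ≤ m ∧ aWarm α m ≤ x ∧ x < dWarm m) →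
        trapPotential β α n (x + 1, 1) = 0 := fun ⟨m, hm, h3, h4⟩ =>
      trapPotential_entrance_of_not fun _ => by
        rcases hsep.disjoint hm hn with rfl | h | h <;> omega
    have t2 : (∃ m, n₀ ≤ m ∧ aWarm α m < x ∧ x ≤ dWarm m) →
        trapPotential β α n (x - 1, 1) = 0 := fun ⟨m, hm, h3, h4⟩ =>
      trapPotential_entrance_of_not fun _ => by
        rcases hsep.disjoint hm hn with rfl | h | h <;> omega
    have t3 : (∃ m, n₀ ≤ m ∧ x = aWarm α m) →
        trapPotential β α n (x, 2) = 0 := fun ⟨m, hm, h3⟩ =>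
      trapPotential_core_of_not fun _ => by
        rcases hsep.disjoint hm hn with rfl | h | h <;> omega
    split_ifs <;> simp [*]

lemma netFlow_trapPotential_core {β α : ℝ} (hβ : 1 < β) {n₀ : ℕ}
    (hsep : WarmupSeparated α n₀) {n : ℕ} (hn₀ : 1 ≤ n₀) (hn : n₀ ≤ n) (x : ℤ) :
    netFlow β (warmupEdges α n₀) (trapPotential β α n) (x, 2) =
      if x = aWarm α n + n then - (β ^ dWarm n * (β - 1)) else 0 := by
  classical
  have hb : β ≠ 0 := by linarith
  have hbx : ∀ y : ℤ, β ^ y ≠ 0 := fun y => zpow_ne_zero y hb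
  have had := aWarm_le α n
  rw [netFlow_warmup]
  simp only [horizontal_mem_warmupEdges, vertical_mem_warmupEdges]
  norm_num
  by_cases hx : aWarm α n ≤ x ∧ x ≤ aWarm α n + n
  · obtain ⟨h1, h2⟩ := hx
    have c1 : (∃ m, n₀ ≤ m ∧ aWarm α m ≤ x ∧ x < aWarm α m + m) ↔ x < aWarm α n + n :=
      ⟨fun ⟨m, hm, h3, h4⟩ => by
        rcases hsep.disjoint hm hn with rfl | h | h <;> omega, fun h => ⟨n, hn, h1, h⟩⟩
    have c2 : (∃ m, n₀ ≤ m ∧ aWarm α m < x ∧ x ≤ aWarm α m + m) ↔ aWarm α n < x :=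
      ⟨fun ⟨m, hm, h3, h4⟩ => by
        rcases hsep.disjoint hm hn with rfl | h | h <;> omega, fun h => ⟨n, hn, by omega, h2⟩⟩
    have c3 : (∃ m, n₀ ≤ m ∧ x = aWarm α m) ↔ x = aWarm α n :=
      ⟨fun ⟨m, hm, h3⟩ => by
        have := aWarm_le α m
        rcases hsep.disjoint hm hn with rfl | h | h <;> omega, fun h => ⟨n, hn, h⟩⟩
    rw [if_congr c1 rfl rfl, if_congr c2 rfl rfl, if_congr c3 rfl rfl,
      trapPotential_core h1 h2]
    have t1 : (if x < aWarm α n + n then β ^ (x + 1) * (trapPotential β α n (x + 1, 2) -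
        (β - 2 + (β + 1) * β ^ eWarm α n - β ^ (dWarm n - x))) else 0) =
        if x < aWarm α n + n then β ^ dWarm n * (β - 1) else 0 := by
      split_ifs with h
      · rw [trapPotential_core (by omega) (by omega), zpow_add_one₀ hb,
          show dWarm n - (x + 1) = dWarm n - x - 1 by ring, zpow_sub_one₀ hb, zpow_sub₀ hb]
        field_simp [hbx]
        ring
      · rfl
    have t2 : (if aWarm α n < x then β ^ x * (trapPotential β α n (x - 1, 2) -
        (β - 2 + (β + 1) * β ^ eWarm α n - β ^ (dWarm n - x))) else 0) =
        if aWarm α n < x then - (β ^ dWarm n * (β - 1)) else 0 := by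
      split_ifs with h
      · rw [trapPotential_core (by omega) (by omega),
          show dWarm n - (x - 1) = dWarm n - x + 1 by ring, zpow_add_one₀ hb, zpow_sub₀ hb]
        field_simp [hbx]
        ring
      · rfl
    have t3 : (if x = aWarm α n then β ^ x * (trapPotential β α n (x, 1) -
        (β - 2 + (β + 1) * β ^ eWarm α n - β ^ (dWarm n - x))) else 0) =
        if x = aWarm α n then - (β ^ dWarm n * (β - 1)) else 0 := by
      split_ifs with h
      · have he : β ^ eWarm α n = β ^ (dWarm n - x) := by
          rw [← zpow_natCast, h, aWarm]
          congr 1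
          ring
        rw [trapPotential_entrance (by omega) (by omega), he, zpow_sub₀ hb]
        field_simp [hbx]
        ring
      · rfl
    rw [t1, t2, t3]
    by_cases e1 : x = aWarm α n
    · rw [if_pos (by omega), if_neg (by omega), if_pos e1, if_neg (by omega)]
      ring
    · by_cases e2 : x = aWarm α n + n
      · rw [if_neg (by omega), if_pos (by omega), if_neg e1, if_pos e2]
        ring
      · rw [if_pos (by omega), if_pos (by omega), if_neg e1, if_neg e2]
        ring
  · rw [trapPotential_core_of_not hx, if_neg (c := x = aWarm α n + n) (by omega)]
    have t1 : (∃ m, n₀ ≤ m ∧ aWarm α m ≤ x ∧ x < aWarm α m + m) →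
        trapPotential β α n (x + 1, 2) = 0 := fun ⟨m, hm, h3, h4⟩ =>
      trapPotential_core_of_not fun _ => by
        rcases hsep.disjoint hm hn with rfl | h | h <;> omega
    have t2 : (∃ m, n₀ ≤ m ∧ aWarm α m < x ∧ x ≤ aWarm α m + m) →
        trapPotential β α n (x - 1, 2) = 0 := fun ⟨m, hm, h3, h4⟩ =>
      trapPotential_core_of_not fun _ => by
        rcases hsep.disjoint hm hn with rfl | h | h <;> omega
    have t3 : (∃ m, n₀ ≤ m ∧ x = aWarm α m) →
        trapPotential β α n (x, 1) = 0 := fun ⟨m, hm, h3⟩ =>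
      trapPotential_entrance_of_not fun _ => by
        rcases hsep.disjoint hm hn with rfl | h | h <;> omega
    split_ifs <;> simp [*]

lemma netFlow_trapPotential {β α : ℝ} (hβ : 1 < β) {n₀ : ℕ} (hsep : WarmupSeparated α n₀)
    (hn₀ : 1 ≤ n₀) {n : ℕ} (hn : n₀ ≤ n) (x y : ℤ) :
    netFlow β (warmupEdges α n₀) (trapPotential β α n) (x, y) =
      (if y = 0 ∧ x = dWarm n then β ^ dWarm n * (β - 1) else 0) -
      (if y = 2 ∧ x = aWarm α n + n then β ^ dWarm n * (β - 1) else 0) := by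
  classical
  have had := aWarm_le α n
  by_cases hy1 : y = 1
  · subst hy1
    rw [netFlow_trapPotential_entrance hβ hsep hn]
    simp
  by_cases hy2 : y = 2
  · subst hy2
    rw [netFlow_trapPotential_core hβ hsep hn₀ hn]
    split_ifs <;> simp_all
  by_cases hy0 : y = 0
  · subst hy0
    rw [netFlow_warmup]
    simp only [horizontal_mem_warmupEdges, vertical_mem_warmupEdges]
    norm_num
    rw [trapPotential_of_ne (y := 0) (by omega) (by omega),
      trapPotential_of_ne (y := 0) (by omega) (by omega),
      trapPotential_of_ne (y := 0) (by omega) (by omega)]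
    by_cases hx : x = dWarm n
    · have hex : ∃ m, n₀ ≤ m ∧ dWarm n = dWarm m := ⟨n, hn, rfl⟩
      rw [hx, if_pos hex, trapPotential_entrance had le_rfl, sub_self (dWarm n), zpow_zero]
      simp only [mul_zero, ite_self, sub_zero, if_true]
      ring
    · rw [if_neg hx]
      have t : (∃ m, n₀ ≤ m ∧ x = dWarm m) →
          trapPotential β α n (x, 1) = 0 := fun ⟨m, hm, h3⟩ =>
        trapPotential_entrance_of_not fun _ => by
          have := aWarm_le α m
          rcases hsep.disjoint hm hn with rfl | h | h <;> omega
      split_ifs <;> simp [*]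
  · have h1 : ∀ w : ℤ, s(((w, y) : V), (w + 1, y)) ∉ warmupEdges α n₀ := fun w h => by
      rcases horizontal_mem_warmupEdges.1 h with h | h | h
      · exact hy0 h.1
      · exact hy1 h.1
      · exact hy2 h.1
    have h3 : s(((x, y) : V), (x, y + 1)) ∉ warmupEdges α n₀ := fun h => by
      rcases vertical_mem_warmupEdges.1 h with h | h
      · exact hy0 h.1
      · exact hy1 h.1
    have h4 : s(((x, y - 1) : V), (x, y - 1 + 1)) ∉ warmupEdges α n₀ := fun h => by
      rcases vertical_mem_warmupEdges.1 h with h | h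
      · exact hy1 (by linarith [h.1])
      · exact hy2 (by linarith [h.1])
    rw [netFlow_warmup, if_neg (h1 x), if_neg (h1 (x - 1)), if_neg h3, if_neg h4,
      if_neg (by tauto), if_neg (by tauto)]
    simp

lemma origin_edge_mem_warmupEdges (α : ℝ) (n₀ : ℕ) :
    s(((0, 0) : V), (0 + 1, 0)) ∈ warmupEdges α n₀ :=
  horizontal_mem_warmupEdges.2 (Or.inl ⟨rfl, le_rfl⟩)

lemma IsWalkLaw.occupation_warmup_le {α β : ℝ} (hβ : 1 < β) {n₀ : ℕ} (hsep : WarmupSeparated α n₀)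
    {μ : Measure (ℕ → V)} (hμ : IsWalkLaw β (warmupEdges α n₀) (0, 0) μ) (z : V) :
    ∑' t, μ {ω | ω t = z} ≤
      ENNReal.ofReal ((β + 3) / (β - 1) * β ^ (z.1 - backbone α n₀ z)) := by
  have hb : 0 < β := by linarith
  have hb0 : β ≠ 0 := hb.ne'
  have hb1 : 0 < β - 1 := by linarith
  have hbx : ∀ y : ℤ, β ^ y ≠ 0 := fun y => zpow_ne_zero y hb0
  set g : ℤ → ℝ := fun k => β ^ (-k) / (β - 1) with hg
  have hg0 : ∀ k, 0 ≤ g k := fun k => by positivity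
  refine (hμ.occupation_le hβ (isLatticeGraph_warmupEdges α n₀)
    (h := fun z => g (backbone α n₀ z)) (fun z => hg0 _) ?_ z).trans
    (ENNReal.ofReal_le_ofReal ?_)
  · rintro ⟨x, y⟩
    rw [sum_edgeWt_mul, netFlow_backbone hsep]
    suffices h : (if ((x, y) : V) = (0, 0) then (1 : ℝ) else 0) + (if y = 0 ∧ 0 ≤ x then
        β ^ (x + 1) * (g (x + 1) - g x) + (if 1 ≤ x then β ^ x * (g (x - 1) - g x) else 0)
        else 0) ≤ 0 by linarith
    have e1 : β ^ (x + 1) * (g (x + 1) - g x) = -1 := by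
      simp only [hg, zpow_neg, zpow_add_one₀ hb0]
      have := hbx x
      field_simp
      ring
    have e2 : β ^ x * (g (x - 1) - g x) = 1 := by
      simp only [hg, zpow_neg, zpow_sub_one₀ hb0]
      have := hbx x
      field_simp
    rw [e1, e2]
    by_cases h0 : x = 0 ∧ y = 0
    · rw [h0.1, h0.2]
      norm_num
    · rw [if_neg (by simpa [Prod.ext_iff] using h0)]
      by_cases h1 : y = 0 ∧ 0 ≤ x
      · rw [if_pos h1, if_pos (by omega)]
        norm_num
      · rw [if_neg h1, zero_add]
  · calc vertWt β (warmupEdges α n₀) z * g (backbone α n₀ z)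
        ≤ ((β + 3) * β ^ z.1) * g (backbone α n₀ z) :=
          mul_le_mul_of_nonneg_right (vertWt_le hβ _ z) (hg0 _)
      _ = _ := by
          simp only [hg]
          rw [sub_eq_add_neg z.1, zpow_add₀ hb0]
          ring

lemma ae_exists_summable_visits {μ : Measure (ℕ → V)} {ι : Type*} [Countable ι] {pt : ι → V}
    {w C : ι → ℝ} (hw : ∀ i, 0 ≤ w i)
    (hocc : ∀ i, ∑' t, μ {ω | ω t = pt i} ≤ ENNReal.ofReal (C i))
    (hsum : Summable fun i => w i * C i) :
    ∀ᵐ ω ∂μ, ∃ a : ℕ → ℝ, Summable a ∧ (∀ t, 0 ≤ a t) ∧ ∀ t i, ω t = pt i → w i ≤ a t := by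
  classical
  set S : (ℕ → V) → ℕ → ℝ≥0∞ := fun ω t =>
    ∑' i, {ω : ℕ → V | ω t = pt i}.indicator (fun _ => ENNReal.ofReal (w i)) ω with hS
  have hmeas : ∀ t i, MeasurableSet {ω : ℕ → V | ω t = pt i} := fun t i =>
    measurableSet_eq_fun (measurable_pi_apply t) measurable_const
  have hSm : ∀ t, Measurable fun ω => S ω t := fun t =>
    Measurable.tsum fun i => measurable_const.indicator (hmeas t i)
  have hint : ∫⁻ ω, ∑' t, S ω t ∂μ ≠ ∞ := by
    rw [lintegral_tsum fun t => (hSm t).aemeasurable]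
    have : ∀ t, ∫⁻ ω, S ω t ∂μ = ∑' i, ENNReal.ofReal (w i) * μ {ω | ω t = pt i} := fun t => by
      rw [lintegral_tsum fun i => (measurable_const.indicator (hmeas t i)).aemeasurable]
      exact tsum_congr fun i => lintegral_indicator_const (hmeas t i) _
    simp only [this]
    rw [ENNReal.tsum_comm]
    refine ne_top_of_le_ne_top hsum.tsum_ofReal_ne_top (ENNReal.tsum_le_tsum fun i => ?_)
    rw [ENNReal.tsum_mul_left, ENNReal.ofReal_mul (hw i)]
    gcongr
    exact hocc i
  filter_upwards [ae_lt_top (Measurable.tsum hSm) hint] with ω hω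
  refine ⟨fun t => (S ω t).toReal, ENNReal.summable_toReal hω.ne, fun t => ENNReal.toReal_nonneg,
    fun t i h => ?_⟩
  rw [← ENNReal.toReal_ofReal (hw i)]
  refine ENNReal.toReal_mono (ENNReal.ne_top_of_tsum_ne_top hω.ne t) ?_
  have hi : ENNReal.ofReal (w i) =
      {ω : ℕ → V | ω t = pt i}.indicator (fun _ => ENNReal.ofReal (w i)) ω :=
    (Set.indicator_of_mem (s := {ω : ℕ → V | ω t = pt i}) h fun _ => ENNReal.ofReal (w i)).symm
  rw [hi]
  exact ENNReal.le_tsum i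

lemma finite_visits {ω : ℕ → V} {ι : Type*} {pt : ι → V} {a : ℕ → ℝ} (ha : Summable a)
    (h : ∀ t i, ω t = pt i → 1 ≤ a t) : {t | ∃ i, ω t = pt i}.Finite := by
  have := ha.tendsto_cofinite_zero.eventually_lt_const one_pos
  refine Set.Finite.subset this ?_
  rintro t ⟨i, hi⟩
  simpa using h t i hi

lemma fst_le_of_path {G : Set (Sym2 V)} (hG : IsLatticeGraph G) {ω : ℕ → V} (h0 : ω 0 = (0, 0))
    (h : ∀ t, s(ω t, ω (t + 1)) ∈ G) (t : ℕ) : (ω t).1 ≤ t := by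
  induction t with
  | zero => simp [h0]
  | succ t ih =>
    have := (latNbrs_fst (hG _ _ (h t))).2
    push_cast
    omega

/-- The core of a trap can only be entered through its left end. -/
lemma exists_entry_of_core {α : ℝ} {n₀ : ℕ} (hsep : WarmupSeparated α n₀) {ω : ℕ → V}
    (h0 : ω 0 = (0, 0)) (h : ∀ t, s(ω t, ω (t + 1)) ∈ warmupEdges α n₀) {n : ℕ} (hn : n₀ ≤ n)
    (t : ℕ) (h2 : (ω t).2 = 2) (ha : aWarm α n ≤ (ω t).1) (hb : (ω t).1 ≤ aWarm α n + n) :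
    ∃ s, ω s = (aWarm α n, 2) := by
  induction t with
  | zero => simp [h0] at h2
  | succ t ih =>
    have ht := h t
    have hG := isLatticeGraph_warmupEdges α n₀ _ _ (by rw [Sym2.eq_swap] at ht; exact ht)
    generalize hz : ω (t + 1) = z at *
    obtain ⟨x, y⟩ := z
    simp only at h2 ha hb
    subst h2
    by_cases hx : x = aWarm α n
    · exact ⟨t + 1, by rw [hz, hx]⟩
    simp only [latNbrs, Finset.mem_insert, Finset.mem_singleton] at hG
    rcases hG with e | e | e | e <;> rw [e] at ht ih
    · rw [Sym2.eq_swap] at ht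
      rcases horizontal_mem_warmupEdges.1 ht with h | h | ⟨-, m, hm, h3, h4⟩
      · omega
      · omega
      · refine ih rfl (by simp only; omega) ?_
        simp only
        rcases hsep.disjoint hm hn with rfl | h | h <;> omega
    · exact ih rfl (by simp only; omega) (by simp only; omega)
    · rw [Sym2.eq_swap] at ht
      rcases vertical_mem_warmupEdges.1 ht with h | h <;> omega
    · rw [show ((x, (2 : ℤ)) : V) = (x, 1 + 1) from rfl] at ht
      rcases vertical_mem_warmupEdges.1 ht with h | ⟨-, m, hm, h3⟩
      · omega
      · exfalso
        have := aWarm_le α m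
        rcases hsep.disjoint hm hn with rfl | h | h <;> omega

lemma sq_le_of_aWarm_le {α : ℝ} {n₀ : ℕ} (hsep : WarmupSeparated α n₀) {n t : ℕ} (hn : n₀ ≤ n)
    (h : aWarm α n ≤ t) : (n : ℝ) ^ 2 ≤ (4 + (n₀ : ℝ) ^ 2) * (t + 1) := by
  have ht : (0 : ℝ) ≤ t := t.cast_nonneg
  rcases hn.eq_or_lt with rfl | hlt
  · nlinarith [sq_nonneg (n₀ : ℝ)]
  · obtain ⟨m, rfl⟩ : ∃ m, n = m + 1 := ⟨n - 1, by omega⟩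
    have h1 : dWarm m < t := (hsep m (m + 1) (by omega) (by omega)).1.trans_le h
    have h2 : (m : ℝ) ^ 3 + 1 ≤ t := by
      have h3 : (m : ℤ) ^ 3 + 1 ≤ t := h1
      exact_mod_cast h3
    have hm : (0 : ℝ) ≤ m := m.cast_nonneg
    push_cast
    have h4 : (m + 1 : ℝ) ^ 2 ≤ 4 * ((m : ℝ) ^ 3 + 2) := by
      nlinarith [mul_nonneg hm (sq_nonneg ((m : ℝ) - 1)), sq_nonneg ((m : ℝ) - 1), hm]
    nlinarith [mul_nonneg (sq_nonneg (n₀ : ℝ)) (by linarith : (0 : ℝ) ≤ t + 1)]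

lemma pow_neg_eWarm_le {α β : ℝ} (hβ : 1 < β) {n : ℕ} (hn : 1 ≤ n) :
    (β ^ eWarm α n)⁻¹ ≤ (n : ℝ) ^ (-(α * Real.log β)) := by
  have hn' : (0 : ℝ) < n := by exact_mod_cast hn
  have h1 : α * Real.log n ≤ eWarm α n := Nat.le_ceil _
  have h2 : 0 < Real.log β := Real.log_pos hβ
  rw [← Real.exp_log (by linarith : 0 < β), ← Real.exp_nat_mul, ← Real.exp_neg,
    Real.rpow_def_of_pos hn', Real.exp_le_exp, Real.log_exp]
  nlinarith

lemma le_pow_neg_eWarm {α β : ℝ} (hα : 0 < α) (hβ : 1 < β) {n : ℕ} (hn : 1 ≤ n) :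
    β⁻¹ * (n : ℝ) ^ (-(α * Real.log β)) ≤ (β ^ eWarm α n)⁻¹ := by
  have hn' : (0 : ℝ) < n := by exact_mod_cast hn
  have h1 : (eWarm α n : ℝ) < α * Real.log n + 1 :=
    Nat.ceil_lt_add_one (mul_nonneg hα.le (Real.log_nonneg (by exact_mod_cast hn)))
  have h2 : 0 < Real.log β := Real.log_pos hβ
  rw [← Real.exp_log (by linarith : 0 < β), ← Real.exp_nat_mul, ← Real.exp_neg, ← Real.exp_neg,
    Real.rpow_def_of_pos hn', ← Real.exp_add, Real.exp_le_exp, Real.log_exp]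
  nlinarith

lemma ae_tendsto_irregCount {α β : ℝ} (hβ : 1 < β) (hγ : 1 < α * Real.log β)
    {n₀ : ℕ} (hn₀ : 1 ≤ n₀) (hsep : WarmupSeparated α n₀) {μ : Measure (ℕ → V)}
    (hμ : IsWalkLaw β (warmupEdges α n₀) (0, 0) μ) :
    ∀ᵐ ω ∂μ, Tendsto (fun t : ℕ => irregCount (warmupEdges α n₀) ω t / t) atTop (nhds 0) := by
  classical
  have hb : 0 < β := by linarith
  have hb1 : 0 < β - 1 := by linarith
  have hocc := hμ.occupation_warmup_le hβ hsep
  have hle : ∀ k, n₀ ≤ k + n₀ := fun k => Nat.le_add_left _ _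
  have hpt : ∀ z : V, ∀ᵐ ω ∂μ, {t | ω t = z}.Finite := fun z => by
    have := ae_exists_summable_visits (ι := Unit) (pt := fun _ => z) (w := fun _ => 1)
      (fun _ => zero_le_one) (fun _ => hocc z) (hasSum_fintype _).summable
    filter_upwards [this] with ω ⟨a, ha, _, h⟩
    simpa using finite_visits ha h
  have hsq : Summable fun k : ℕ => 1 / ((k + n₀ : ℕ) : ℝ) ^ 2 :=
    (summable_nat_add_iff n₀).2 (Real.summable_one_div_nat_pow.2 one_lt_two)
  have hvis : ∀ pt : ℕ → V, (∀ k, (pt k).1 ≤ backbone α n₀ (pt k)) →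
      ∀ᵐ ω ∂μ, ∃ a : ℕ → ℝ, Summable a ∧ (∀ t, 0 ≤ a t) ∧
        ∀ t k, ω t = pt k → 1 / ((k + n₀ : ℕ) : ℝ) ^ 2 ≤ a t := fun pt hpt => by
    refine ae_exists_summable_visits (C := fun _ => (β + 3) / (β - 1)) (fun k => by positivity)
      (fun k => (hocc _).trans (ENNReal.ofReal_le_ofReal ?_))
      (hsq.mul_right _)
    exact mul_le_of_le_one_right (by positivity)
      (zpow_le_one_of_nonpos₀ hβ.le (by linarith [hpt k]))
  have h1 := hvis (fun k => (dWarm (k + n₀), 0)) fun k => (backbone_zero _ _ _).ge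
  have h2 := hvis (fun k => (dWarm (k + n₀), 1)) fun k =>
    (backbone_trap hsep one_ne_zero (hle k) (aWarm_le _ _) (Or.inl le_rfl)).ge
  have h3 := hvis (fun k => (aWarm α (k + n₀), 1)) fun k => by
    rw [backbone_trap hsep one_ne_zero (hle k) le_rfl (Or.inl (aWarm_le _ _))]
    exact aWarm_le _ _
  have h4 : ∀ᵐ ω ∂μ, ∃ a : ℕ → ℝ, Summable a ∧ (∀ t, 0 ≤ a t) ∧
      ∀ t k, ω t = (aWarm α (k + n₀), 2) → 1 ≤ a t := by
    refine ae_exists_summable_visits (pt := fun k : ℕ => (aWarm α (k + n₀), 2))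
      (C := fun k => (β + 3) / (β - 1) * ((k + n₀ : ℕ) : ℝ) ^ (-(α * Real.log β)))
      (fun k => zero_le_one)
      (fun k => (hocc _).trans (ENNReal.ofReal_le_ofReal ?_)) ?_
    · rw [backbone_trap hsep two_ne_zero (hle k) le_rfl (Or.inl (aWarm_le _ _))]
      gcongr
      refine le_trans (le_of_eq ?_) (pow_neg_eWarm_le hβ (hn₀.trans (hle k)))
      rw [← zpow_natCast, ← zpow_neg, aWarm]
      congr 1
      simp
    · simp only [one_mul]
      exact ((summable_nat_add_iff n₀).2 (Real.summable_nat_rpow.2 (by linarith))).mul_left _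
  filter_upwards [h1, h2, h3, h4, hpt (0, 0),
    ae_all_iff.2 fun n : ℕ => hpt (aWarm α n + n, 2), hμ.ae_start,
    hμ.ae_path hβ (isLatticeGraph_warmupEdges α n₀) (origin_edge_mem_warmupEdges α n₀)]
    with ω ⟨a₁, s₁, p₁, q₁⟩ ⟨a₂, s₂, p₂, q₂⟩ ⟨a₃, s₃, p₃, q₃⟩ ⟨a₄, s₄, p₄, q₄⟩ hO hE hstart hpath
  have hentry : {n | n₀ ≤ n ∧ ∃ t, ω t = (aWarm α n + n, 2)}.Finite := by
    have hfin := (finite_visits s₄ q₄).image fun t => trapIdx α n₀ (ω t).1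
    refine hfin.subset ?_
    rintro n ⟨hn, t, ht⟩
    obtain ⟨s, hs⟩ := exists_entry_of_core hsep hstart hpath hn t (by rw [ht]) (by rw [ht]; simp)
      (by rw [ht])
    refine ⟨s, ⟨n - n₀, by rw [hs, Nat.sub_add_cancel hn]⟩, ?_⟩
    simp only [hs]
    exact trapIdx_eq hsep hn le_rfl (Or.inl (aWarm_le _ _))
  set B : Set ℕ := {t | ω t = (0, 0)} ∪
    ⋃ n ∈ {n | n₀ ≤ n ∧ ∃ t, ω t = (aWarm α n + n, 2)}, {t | ω t = (aWarm α n + n, 2)} with hB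
  have hBfin : B.Finite := hO.union (hentry.biUnion fun n _ => hE n)
  set K : ℝ := 4 + (n₀ : ℝ) ^ 2 with hK
  have hK4 : 4 ≤ K := by
    rw [hK]
    linarith [sq_nonneg (n₀ : ℝ)]
  refine tendsto_sum_div_of_le_mul
    (a := fun t => (B.indicator (fun _ => 1) t) + K * (a₁ t + a₂ t + a₃ t + a₄ t))
    (fun t => by split_ifs <;> norm_num) ?_ (fun t => ?_) fun t => ?_
  · exact (summable_of_hasFiniteSupport (hBfin.subset (by simp))).add
      ((((s₁.add s₂).add s₃).add s₄).mul_left K)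
  · have := p₁ t; have := p₂ t; have := p₃ t; have := p₄ t
    have : 0 ≤ B.indicator (fun _ => (1 : ℝ)) t := Set.indicator_nonneg (fun _ _ => zero_le_one) t
    positivity
  · have i0 : 0 ≤ B.indicator (fun _ => (1 : ℝ)) t :=
      Set.indicator_nonneg (fun _ _ => zero_le_one) t
    have i1 := p₁ t
    have i2 := p₂ t
    have i3 := p₃ t
    have i4 := p₄ t
    have it : (0 : ℝ) ≤ t := t.cast_nonneg
    have hx := fst_le_of_path (isLatticeGraph_warmupEdges α n₀) hstart hpath t
    have key : ∀ b : ℝ, b ≤ a₁ t + a₂ t + a₃ t + a₄ t → 1 ≤ b * (K * (t + 1)) →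
        1 ≤ (B.indicator (fun _ => (1 : ℝ)) t + K * (a₁ t + a₂ t + a₃ t + a₄ t)) * (t + 1) :=
      fun b hb h => by
        have : b * (K * (t + 1)) ≤ (a₁ t + a₂ t + a₃ t + a₄ t) * (K * (t + 1)) := by gcongr
        nlinarith
    have keyB : t ∈ B →
        1 ≤ (B.indicator (fun _ => (1 : ℝ)) t + K * (a₁ t + a₂ t + a₃ t + a₄ t)) * (t + 1) :=
      fun h => by
        rw [Set.indicator_of_mem h]
        have : 0 ≤ K * (a₁ t + a₂ t + a₃ t + a₄ t) := by positivity
        nlinarith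
    have keyn : ∀ n : ℕ, n₀ ≤ n → aWarm α n ≤ (ω t).1 → 1 ≤ 1 / (n : ℝ) ^ 2 * (K * (t + 1)) :=
      fun n hn ha => by
        have hn' : (0 : ℝ) < n := by exact_mod_cast hn₀.trans hn
        rw [one_div_mul_eq_div, one_le_div (by positivity)]
        exact sq_le_of_aWarm_le hsep hn (ha.trans hx)
    split_ifs with hreg
    · positivity
    rcases irregular_cases (inWarmup_of_mem hn₀ (hpath t)) hreg with
      h | ⟨n, hn, h⟩
    · exact keyB (Or.inl h)
    obtain ⟨k, rfl⟩ : ∃ k, n = k + n₀ := ⟨n - n₀, by omega⟩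
    rcases h with h | h | h | h | h
    · exact key _ (by linarith [q₁ t k h]) (keyn _ hn (by rw [h]; exact aWarm_le _ _))
    · exact key _ (by linarith [q₂ t k h]) (keyn _ hn (by rw [h]; exact aWarm_le _ _))
    · exact key _ (by linarith [q₃ t k h]) (keyn _ hn (by rw [h]))
    · refine key 1 (by linarith [q₄ t k h]) ?_
      nlinarith
    · refine keyB (Or.inr ?_)
      simp only [Set.mem_iUnion]
      exact ⟨k + n₀, ⟨hn, t, h⟩, h⟩

/-- The potential of a current flowing from infinity to the end of the core of the `n`-th trap. -/
def corePotential (β α : ℝ) (n₀ n : ℕ) (z : V) : ℝ :=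
  max 0 (1 - β ^ (dWarm n - backbone α n₀ z)) - trapPotential β α n z

lemma netFlow_corePotential {β α : ℝ} (hβ : 1 < β) {n₀ : ℕ} (hsep : WarmupSeparated α n₀)
    (hn₀ : 1 ≤ n₀) {n : ℕ} (hn : n₀ ≤ n) (x y : ℤ) :
    netFlow β (warmupEdges α n₀) (corePotential β α n₀ n) (x, y) =
      if y = 2 ∧ x = aWarm α n + n then β ^ dWarm n * (β - 1) else 0 := by
  have hb : 0 < β := by linarith
  have hb0 : β ≠ 0 := hb.ne'
  have hd := one_le_dWarm (hn₀.trans hn)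
  set g : ℤ → ℝ := fun k => max 0 (1 - β ^ (dWarm n - k)) with hg
  have g0 : ∀ k ≤ dWarm n, g k = 0 := fun k hk =>
    max_eq_left (by linarith [one_le_zpow₀ hβ.le (by omega : 0 ≤ dWarm n - k)])
  have g1 : ∀ k, dWarm n ≤ k → g k = 1 - β ^ (dWarm n - k) := fun k hk =>
    max_eq_right (by linarith [zpow_le_one_of_nonpos₀ hβ.le (by omega : dWarm n - k ≤ 0)])
  have hsub : netFlow β (warmupEdges α n₀) (corePotential β α n₀ n) (x, y) =
      netFlow β (warmupEdges α n₀) (fun z => g (backbone α n₀ z)) (x, y) -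
        netFlow β (warmupEdges α n₀) (trapPotential β α n) (x, y) := by
    rw [netFlow, netFlow, netFlow, ← Finset.sum_sub_distrib]
    refine Finset.sum_congr rfl fun w _ => ?_
    simp only [corePotential, hg]
    ring
  have hback : netFlow β (warmupEdges α n₀) (fun z => g (backbone α n₀ z)) (x, y) =
      if y = 0 ∧ x = dWarm n then β ^ dWarm n * (β - 1) else 0 := by
    rw [netFlow_backbone hsep]
    by_cases hy : y = 0 ∧ 0 ≤ x
    · rw [if_pos hy]
      rcases lt_trichotomy x (dWarm n) with h | h | h
      · rw [g0 _ h.le, g0 _ (by omega), g0 _ (by omega),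
          if_neg (c := y = 0 ∧ x = dWarm n) (by omega)]
        simp
      · rw [g0 x h.le, g1 (x + 1) (by omega), g0 (x - 1) (by omega),
          if_pos (c := y = 0 ∧ x = dWarm n) ⟨hy.1, h⟩, h,
          show dWarm n - (dWarm n + 1) = -1 by ring, zpow_add_one₀ hb0, zpow_neg_one]
        field_simp
        simp
      · have := zpow_ne_zero x hb0
        rw [g1 x h.le, g1 (x + 1) (by omega), g1 (x - 1) (by omega),
          if_neg (c := y = 0 ∧ x = dWarm n) (by omega), if_pos (by omega), show dWarm n - (x + 1) = dWarm n - x - 1 by ring,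
          show dWarm n - (x - 1) = dWarm n - x + 1 by ring, zpow_add_one₀ hb0, zpow_add_one₀ hb0,
          zpow_sub_one₀ hb0, zpow_sub₀ hb0]
        field_simp
        ring
    · rw [if_neg hy, if_neg (by omega)]
  rw [hsub, hback, netFlow_trapPotential hβ hsep hn₀ hn]
  ring

lemma trapPotential_le {β α : ℝ} (hβ : 1 < β) {n₀ : ℕ} (hsep : WarmupSeparated α n₀) {n : ℕ}
    (hn : n₀ ≤ n) (z : V) : trapPotential β α n z ≤
      if n = trapIdx α n₀ z.1 then (2 * β + 1) * β ^ eWarm α n else 0 := by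
  have hb : 0 < β := by linarith
  have he : 1 ≤ β ^ eWarm α n := one_le_pow₀ hβ.le
  unfold trapPotential
  split_ifs with h1 h2 h3 h4
  · have : β ^ (dWarm n - z.1) ≤ β ^ eWarm α n := by
      rw [← zpow_natCast]
      refine zpow_le_zpow_right₀ hβ.le ?_
      have := h1.2.1
      unfold aWarm at this
      omega
    nlinarith
  · exact absurd (trapIdx_eq hsep hn h1.2.1 (Or.inl h1.2.2)).symm h2
  · have : 0 < β ^ (dWarm n - z.1) := zpow_pos hb _
    nlinarith
  · exact absurd (trapIdx_eq hsep hn h3.2.1 (Or.inr h3.2.2)).symm h4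
  · positivity
  · rfl

lemma sum_le_of_le_ite {s : Finset ℕ} {f : ℕ → ℝ} {i : ℕ} {M : ℝ} (hM : 0 ≤ M)
    (h : ∀ n ∈ s, f n ≤ if n = i then M else 0) : ∑ n ∈ s, f n ≤ M := by
  refine (Finset.sum_le_sum h).trans ?_
  rw [Finset.sum_ite_eq']
  split_ifs
  exacts [le_rfl, hM]

/-- The walk does not advance beyond the traps of index in `(N, 2 N]` without spending a time of
order `β ^ N` with high probability. -/
lemma IsWalkLaw.measure_backbone_gt_le {α β : ℝ} (hα : 0 < α) (hβ : 1 < β) {n₀ : ℕ} (hn₀ : 1 ≤ n₀)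
    (hsep : WarmupSeparated α n₀) {μ : Measure (ℕ → V)}
    (hμ : IsWalkLaw β (warmupEdges α n₀) (0, 0) μ) :
    ∃ c C : ℝ, 0 < c ∧ 0 < C ∧ ∀ N T : ℕ, n₀ ≤ N →
      ENNReal.ofReal (c * (N : ℝ) ^ (1 - α * Real.log β)) *
        μ {ω | ∃ s < T, ω s ∈ {z | dWarm (2 * N) < backbone α n₀ z}} ≤
      ENNReal.ofReal ((1 + C * β⁻¹ ^ N) ^ T) := by
  have hb : 0 < β := by linarith
  have hb0 : β ≠ 0 := hb.ne'
  have hb1 : 0 < β - 1 := by linarith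
  have hlog : 0 < Real.log β := Real.log_pos hβ
  set γ := α * Real.log β with hγ
  have hγ0 : 0 ≤ γ := by positivity
  set κ : ℝ := 1 / (2 * (2 * β + 1)) with hκ
  have hκ0 : 0 < κ := by positivity
  have hβi : β⁻¹ < 1 := inv_lt_one_of_one_lt₀ hβ
  have h1β : 0 < 1 - β⁻¹ := by linarith
  refine ⟨κ * (1 - β⁻¹) * (β⁻¹ * 2 ^ (-γ)), 2 * κ * (β - 1), by positivity, by positivity,
    fun N T hN => ?_⟩
  set W := Finset.Ioc N (2 * N) with hW
  have hWn : ∀ n ∈ W, n₀ ≤ n ∧ N ≤ n ∧ n ≤ 2 * N := fun n hn => by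
    rw [hW, Finset.mem_Ioc] at hn
    omega
  set u : V → ℝ := fun z => 1 + κ * ∑ n ∈ W, (β ^ eWarm α n)⁻¹ * corePotential β α n₀ n z with hu
  have hlow : ∀ z, 1 / 2 + κ * ∑ n ∈ W, (β ^ eWarm α n)⁻¹ *
      max 0 (1 - β ^ (dWarm n - backbone α n₀ z)) ≤ u z := fun z => by
    have h1 : ∑ n ∈ W, (β ^ eWarm α n)⁻¹ * trapPotential β α n z ≤ 2 * β + 1 := by
      refine sum_le_of_le_ite (i := trapIdx α n₀ z.1) (by positivity) fun n hn => ?_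
      refine (mul_le_mul_of_nonneg_left (trapPotential_le hβ hsep (hWn n hn).1 z)
        (by positivity)).trans (le_of_eq ?_)
      split_ifs
      · field_simp
      · ring
    have h2 : κ * (2 * β + 1) = 1 / 2 := by
      rw [hκ]
      field_simp
    have h3 := mul_le_mul_of_nonneg_left h1 hκ0.le
    simp only [hu, corePotential, mul_sub, Finset.sum_sub_distrib]
    linarith
  have hhalf : ∀ z, 1 / 2 ≤ u z := fun z => by
    refine le_trans ?_ (hlow z)
    have : 0 ≤ ∑ n ∈ W, (β ^ eWarm α n)⁻¹ * max 0 (1 - β ^ (dWarm n - backbone α n₀ z)) :=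
      Finset.sum_nonneg fun n _ => mul_nonneg (by positivity) (le_max_left _ _)
    nlinarith
  have hflow : ∀ z, netFlow β (warmupEdges α n₀) u z =
      κ * ∑ n ∈ W, (β ^ eWarm α n)⁻¹ * netFlow β (warmupEdges α n₀) (corePotential β α n₀ n) z :=
    fun z => by
      simp only [netFlow, Finset.mul_sum]
      rw [Finset.sum_comm]
      refine Finset.sum_congr rfl fun w _ => ?_
      simp only [hu]
      rw [add_sub_add_left_eq_sub, ← mul_sub, ← Finset.sum_sub_distrib, Finset.mul_sum,
        Finset.mul_sum]
      exact Finset.sum_congr rfl fun n _ => by ring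
  have hv : ∀ z, 0 ≤ vertWt β (warmupEdges α n₀) z := vertWt_nonneg hβ _
  have hflow_le : ∀ z, netFlow β (warmupEdges α n₀) u z ≤
      κ * ((β - 1) * β⁻¹ ^ N * vertWt β (warmupEdges α n₀) z) := by
    rintro ⟨x, y⟩
    rw [hflow]
    refine mul_le_mul_of_nonneg_left (sum_le_of_le_ite (i := trapIdx α n₀ x)
      (mul_nonneg (by positivity) (hv _)) fun n hn => ?_) hκ0.le
    obtain ⟨hn1, hn2, -⟩ := hWn n hn
    rw [netFlow_corePotential hβ hsep hn₀ hn1]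
    split_ifs with h1 h2 h2
    · have hedge : s(((x, y) : V), (x - 1, y)) ∈ warmupEdges α n₀ :=
        left_mem_warmupEdges.2 (horizontal_mem_warmupEdges.2
          (Or.inr (Or.inr ⟨h1.1, n, hn1, by omega, by omega⟩)))
      have hw : β ^ x ≤ vertWt β (warmupEdges α n₀) (x, y) := by
        refine le_trans (le_of_eq ?_) (Finset.single_le_sum
          (fun w _ => edgeWt_nonneg hβ (warmupEdges α n₀) (x, y) w)
          (isLatticeGraph_warmupEdges α n₀ _ _ hedge))
        rw [edgeWt, if_pos hedge, max_eq_left (by simp)]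
      have hpow : (β ^ eWarm α n)⁻¹ * β ^ dWarm n = β⁻¹ ^ n * β ^ x := by
        have hd : dWarm n = aWarm α n + eWarm α n := by simp [aWarm]
        rw [h1.2, hd, zpow_add₀ hb0, zpow_add₀ hb0, zpow_natCast, zpow_natCast, inv_pow]
        field_simp
      calc (β ^ eWarm α n)⁻¹ * (β ^ dWarm n * (β - 1))
          = (β - 1) * β⁻¹ ^ n * β ^ x := by rw [← mul_assoc, hpow]; ring
        _ ≤ (β - 1) * β⁻¹ ^ N * vertWt β (warmupEdges α n₀) (x, y) := by
            gcongr ?_ * ?_ * ?_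
            exact pow_le_pow_of_le_one (by positivity) hβi.le hn2
    · exact absurd (trapIdx_eq hsep hn1 (by omega) (Or.inr h1.2.le)).symm h2
    · rw [mul_zero]
      exact mul_nonneg (by positivity) (hv _)
    · rw [mul_zero]
  have hu0 : u (0, 0) = 1 := by
    simp only [hu]
    rw [Finset.sum_eq_zero, mul_zero, add_zero]
    intro n hn
    have hd := one_le_dWarm (hn₀.trans (hWn n hn).1)
    rw [corePotential, trapPotential_of_ne (by omega) (by omega), backbone_zero, max_eq_left,
      sub_zero, mul_zero]
    linarith [one_le_zpow₀ hβ.le (by omega : 0 ≤ dWarm n - 0)]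
  have hup : ∀ z ∈ {z | dWarm (2 * N) < backbone α n₀ z},
      κ * (1 - β⁻¹) * (β⁻¹ * 2 ^ (-γ)) * (N : ℝ) ^ (1 - γ) ≤ u z := fun z hz => by
    have hN0 : (0 : ℝ) < N := by exact_mod_cast hn₀.trans hN
    have hterm : ∀ n ∈ W, (1 - β⁻¹) * (β⁻¹ * (2 ^ (-γ) * (N : ℝ) ^ (-γ))) ≤
        (β ^ eWarm α n)⁻¹ * max 0 (1 - β ^ (dWarm n - backbone α n₀ z)) := fun n hn => by
      obtain ⟨hn1, hn2, hn3⟩ := hWn n hn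
      have hn0 : (0 : ℝ) < n := by exact_mod_cast hn₀.trans hn1
      have hd : dWarm n ≤ dWarm (2 * N) := by
        unfold dWarm
        gcongr
      have hz' : dWarm (2 * N) < backbone α n₀ z := hz
      have h1 : 1 - β⁻¹ ≤ max 0 (1 - β ^ (dWarm n - backbone α n₀ z)) := by
        refine le_max_of_le_right ?_
        rw [← zpow_neg_one]
        gcongr
        · exact hβ.le
        · omega
      have h2 : (2 : ℝ) ^ (-γ) * (N : ℝ) ^ (-γ) ≤ (n : ℝ) ^ (-γ) := by
        rw [← Real.mul_rpow (by norm_num) hN0.le]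
        refine Real.rpow_le_rpow_of_nonpos hn0 (by exact_mod_cast hn3) (by linarith)
      have h3 := le_pow_neg_eWarm hα hβ (hn₀.trans hn1)
      rw [mul_comm]
      refine mul_le_mul (le_trans ?_ h3) h1 h1β.le (by positivity)
      gcongr
    have hsum := Finset.card_nsmul_le_sum W _ _ hterm
    have hcard : W.card = N := by
      rw [hW, Nat.card_Ioc]
      omega
    rw [hcard, nsmul_eq_mul] at hsum
    have h4 : (N : ℝ) ^ (1 - γ) = N * (N : ℝ) ^ (-γ) := by
      rw [sub_eq_add_neg, Real.rpow_add hN0, Real.rpow_one]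
    rw [h4]
    have := mul_le_mul_of_nonneg_left hsum hκ0.le
    linarith [hlow z]
  have hfin := hμ.measure_hit_le hβ (isLatticeGraph_warmupEdges α n₀) (u := u)
    (K := 1 + 2 * κ * (β - 1) * β⁻¹ ^ N) (le_add_of_nonneg_right (by positivity))
    (fun z => by linarith [hhalf z]) (fun z => ?_) hup T
  · rwa [hu0, mul_one] at hfin
  · rw [sum_edgeWt_mul]
    have h1 : 0 ≤ κ * ((β - 1) * β⁻¹ ^ N * vertWt β (warmupEdges α n₀) z) :=
      mul_nonneg hκ0.le (mul_nonneg (by positivity) (hv z))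
    have h2 := mul_le_mul_of_nonneg_right (hhalf z) h1
    linarith [hflow_le z]

lemma IsWalkLaw.ae_eventually_backbone_le {α β : ℝ} (hα : 0 < α) (hβ : 1 < β)
    (hγ : α * Real.log β < 1) {n₀ : ℕ} (hn₀ : 1 ≤ n₀)
    (hsep : WarmupSeparated α n₀) {μ : Measure (ℕ → V)}
    (hμ : IsWalkLaw β (warmupEdges α n₀) (0, 0) μ) :
    ∀ᵐ ω ∂μ, ∀ᶠ k : ℕ in atTop, ∀ s < 32 ^ k, backbone α n₀ (ω s) ≤ dWarm (2 * 2 ^ k) := by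
  obtain ⟨c, C, hc, hC, h⟩ := hμ.measure_backbone_gt_le hα hβ hn₀ hsep
  have hb : 0 < β := by linarith
  have hβi : β⁻¹ < 1 := inv_lt_one_of_one_lt₀ hβ
  set p := 1 - α * Real.log β with hp
  have hp0 : 0 < p := by linarith
  have htwo : Tendsto (fun k : ℕ => 2 ^ k) atTop atTop :=
    tendsto_pow_atTop_atTop_of_one_lt one_lt_two
  have hlim : Tendsto (fun k : ℕ => C * (((2 ^ k : ℕ) : ℝ) ^ 5 * β⁻¹ ^ (2 ^ k))) atTop (nhds 0) := by
    have := ((tendsto_pow_const_mul_const_pow_of_abs_lt_one 5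
      (by rwa [abs_of_pos (inv_pos.2 hb)])).comp htwo).const_mul C
    simpa using this
  set E : ℕ → Set (ℕ → V) := fun k =>
    {ω | ∃ s < 32 ^ k, ω s ∈ {z | dWarm (2 * 2 ^ k) < backbone α n₀ z}} with hE
  have hbound : ∀ᶠ k in atTop,
      μ (E k) ≤ ENNReal.ofReal (Real.exp 1 / c * ((2 : ℝ) ^ (-p)) ^ k) := by
    filter_upwards [hlim.eventually_le_const one_pos, htwo.eventually_ge_atTop n₀] with k hk1 hk2
    have hpos : 0 < c * ((2 ^ k : ℕ) : ℝ) ^ p := by positivity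
    have hK : (1 + C * β⁻¹ ^ (2 ^ k)) ^ (32 ^ k) ≤ Real.exp 1 := by
      have h1 : 1 + C * β⁻¹ ^ (2 ^ k) ≤ Real.exp (C * β⁻¹ ^ (2 ^ k)) := by
        rw [add_comm]
        exact Real.add_one_le_exp _
      refine (pow_le_pow_left₀ (by positivity) h1 _).trans ?_
      rw [← Real.exp_nat_mul, Real.exp_le_exp]
      refine le_trans (le_of_eq ?_) hk1
      push_cast
      rw [← pow_mul, mul_comm k 5, pow_mul]
      norm_num
      ring
    have hm := (h (2 ^ k) (32 ^ k) hk2).trans (ENNReal.ofReal_le_ofReal hK)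
    rw [mul_comm, ← ENNReal.le_div_iff_mul_le (Or.inl (by simpa using hpos))
      (Or.inl ENNReal.ofReal_ne_top), ← ENNReal.ofReal_div_of_pos hpos] at hm
    refine hm.trans (ENNReal.ofReal_le_ofReal (le_of_eq ?_))
    have : ((2 ^ k : ℕ) : ℝ) ^ p = ((2 : ℝ) ^ p) ^ k := by
      push_cast
      rw [← Real.rpow_natCast, ← Real.rpow_natCast, ← Real.rpow_mul (by norm_num),
        ← Real.rpow_mul (by norm_num), mul_comm]
    rw [this, Real.rpow_neg (by norm_num), inv_pow]
    field_simp
  obtain ⟨k₀, hk₀⟩ := eventually_atTop.1 hbound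
  have hr : (2 : ℝ) ^ (-p) < 1 := Real.rpow_lt_one_of_one_lt_of_neg one_lt_two (by linarith)
  have hsum : ∑' k, μ (E (k + k₀)) ≠ ∞ := by
    have hs : Summable fun k => Real.exp 1 / c * ((2 : ℝ) ^ (-p)) ^ (k + k₀) :=
      (summable_nat_add_iff k₀).2 ((summable_geometric_of_lt_one (by positivity) hr).mul_left _)
    exact ne_top_of_le_ne_top hs.tsum_ofReal_ne_top
      (ENNReal.tsum_le_tsum fun k => hk₀ _ (Nat.le_add_left _ _))
  filter_upwards [ae_eventually_notMem hsum] with ω hω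
  obtain ⟨k₁, hk₁⟩ := eventually_atTop.1 hω
  filter_upwards [eventually_ge_atTop (k₁ + k₀)] with k hk s hs
  have := hk₁ (k - k₀) (by omega)
  rw [Nat.sub_add_cancel (by omega)] at this
  by_contra! hlt
  exact this ⟨s, hs, hlt⟩

lemma InWarmup.fst_le {α : ℝ} {n₀ : ℕ} (hsep : WarmupSeparated α n₀) (hn₀ : 1 ≤ n₀) {z : V}
    (hz : InWarmup α n₀ z) : z.1 ≤ 2 * backbone α n₀ z := by
  obtain ⟨x, y⟩ := z
  rcases hz with ⟨h, h1⟩ | ⟨n, hn, h, h1, h2⟩ | ⟨n, hn, h, h1, h2⟩ <;> simp only at h h1 <;> subst h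
  · rw [backbone_zero]
    simp only
    omega
  · have := one_le_dWarm (hn₀.trans hn)
    rw [backbone_trap hsep one_ne_zero hn h1 (Or.inl h2)]
    simp only at h2 ⊢
    omega
  · have h3 : (n : ℤ) ≤ dWarm n := le_self_pow₀ (by exact_mod_cast hn₀.trans hn) (by norm_num)
    have := aWarm_le α n
    rw [backbone_trap hsep two_ne_zero hn h1 (Or.inr h2)]
    simp only at h2 ⊢
    omega

lemma InWarmup.le_fst {α : ℝ} {n₀ : ℕ} (hsep : WarmupSeparated α n₀) (hn₀ : 1 ≤ n₀) {z : V}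
    (hz : InWarmup α n₀ z) : -|aWarm α n₀| ≤ z.1 := by
  have h0 := neg_abs_le (aWarm α n₀)
  have h1 := abs_nonneg (aWarm α n₀)
  have h2 : ∀ n, n₀ ≤ n → -|aWarm α n₀| ≤ aWarm α n := fun n hn => by
    have := one_le_dWarm hn₀
    rcases hn.eq_or_lt with rfl | hlt
    · exact h0
    · have := (hsep n₀ n le_rfl hlt).1
      unfold aWarm at *
      omega
  rcases hz with ⟨-, h⟩ | ⟨n, hn, -, h, -⟩ | ⟨n, hn, -, h, -⟩
  · omega
  · exact (h2 n hn).trans h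
  · exact (h2 n hn).trans h

lemma IsWalkLaw.ae_tendsto_zero {α β : ℝ} (hα : 0 < α) (hβ : 1 < β)
    (hγ : α * Real.log β < 1) {n₀ : ℕ} (hn₀ : 1 ≤ n₀)
    (hsep : WarmupSeparated α n₀) {μ : Measure (ℕ → V)}
    (hμ : IsWalkLaw β (warmupEdges α n₀) (0, 0) μ) :
    ∀ᵐ ω ∂μ, Tendsto (fun t : ℕ => ((ω t).1 : ℝ) / t) atTop (nhds 0) := by
  filter_upwards [hμ.ae_eventually_backbone_le hα hβ hγ hn₀ hsep,
    hμ.ae_path hβ (isLatticeGraph_warmupEdges α n₀) (origin_edge_mem_warmupEdges α n₀)]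
    with ω hω hpath
  have hin : ∀ t, InWarmup α n₀ (ω t) := fun t => inWarmup_of_mem hn₀ (hpath t)
  have hlog : Tendsto (fun t : ℕ => Nat.log 32 t) atTop atTop :=
    tendsto_atTop_atTop.2 fun b => ⟨32 ^ b, fun t ht => Nat.le_log_of_pow_le (by norm_num) ht⟩
  have hupper : Tendsto (fun t : ℕ => 128 * (1 / 4 : ℝ) ^ Nat.log 32 t) atTop (nhds 0) := by
    have := ((tendsto_pow_atTop_nhds_zero_of_lt_one (by norm_num : (0 : ℝ) ≤ 1 / 4)
      (by norm_num)).comp hlog).const_mul 128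
    simpa using this
  have hlower : Tendsto (fun t : ℕ => ((-|aWarm α n₀| : ℤ) : ℝ) / t) atTop (nhds 0) :=
    tendsto_const_div_atTop_nhds_zero_nat _
  refine tendsto_of_tendsto_of_tendsto_of_le_of_le' hlower hupper ?_ ?_
  · refine Eventually.of_forall fun t => ?_
    have : ((-|aWarm α n₀| : ℤ) : ℝ) ≤ (ω t).1 := by exact_mod_cast (hin t).le_fst hsep hn₀
    gcongr
  · filter_upwards [((tendsto_add_atTop_nat 1).comp hlog).eventually hω, eventually_ge_atTop 1]
      with t h1 ht
    set j := Nat.log 32 t with hj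
    have hlt : t < 32 ^ (j + 1) := Nat.lt_pow_succ_log_self (by norm_num) t
    have hle : 32 ^ j ≤ t := Nat.pow_log_le_self 32 (by omega)
    have h2 : backbone α n₀ (ω t) ≤ dWarm (2 * 2 ^ (j + 1)) := h1 t hlt
    have h3 := (hin t).fst_le hsep hn₀
    have h4 : (ω t).1 ≤ 128 * 8 ^ j := by
      refine (h3.trans (mul_le_mul_of_nonneg_left h2 two_pos.le)).trans (le_of_eq ?_)
      simp only [dWarm]
      push_cast
      rw [show (8 : ℤ) = 2 ^ 3 by norm_num, ← pow_mul, mul_comm 3 j, pow_mul]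
      ring
    have h5 : ((ω t).1 : ℝ) ≤ 128 * 8 ^ j := by exact_mod_cast h4
    have h6 : (32 : ℝ) ^ j ≤ t := by exact_mod_cast hle
    have h7 : (0 : ℝ) < t := by exact_mod_cast ht
    rw [div_le_iff₀ h7]
    refine h5.trans ?_
    have h8 : (128 : ℝ) * 8 ^ j = 128 * (1 / 4) ^ j * 32 ^ j := by
      rw [mul_assoc, ← mul_pow]
      norm_num
    rw [h8]
    gcongr

/-- Proposition 2.1. On the warm-up configuration with parameter `α > 0`, the β-biased
random walk started at the origin a.s. has speed `0` if `β < e^{1/α}` and speed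
`(β-1)/(β+1)` if `β > e^{1/α}`. -/
theorem warmup_speed (α : ℝ) (hα : 0 < α) (n₀ : ℕ) (hn₀ : 1 ≤ n₀)
    (hsep : WarmupSeparated α n₀) (β : ℝ) (hβ : 1 < β) (μ : Measure (ℕ → V))
    (hμ : IsWalkLaw β (warmupEdges α n₀) ((0, 0) : V) μ) :
    (β < Real.exp (1 / α) →
        ∀ᵐ ω ∂μ, Tendsto (fun t : ℕ => ((ω t).1 : ℝ) / t) atTop (nhds 0)) ∧
      (Real.exp (1 / α) < β →
        ∀ᵐ ω ∂μ, Tendsto (fun t : ℕ => ((ω t).1 : ℝ) / t) atTop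
          (nhds ((β - 1) / (β + 1)))) := by
  have hb : 0 < β := by linarith
  constructor
  · intro h
    refine hμ.ae_tendsto_zero hα hβ ?_ hn₀ hsep
    rwa [← Real.log_lt_iff_lt_exp hb, lt_div_iff₀ hα, mul_comm] at h
  · intro h
    refine hμ.ae_tendsto_speed hβ (isLatticeGraph_warmupEdges α n₀)
      (origin_edge_mem_warmupEdges α n₀) (ae_tendsto_irregCount hβ ?_ hn₀ hsep hμ)
    rwa [← Real.lt_log_iff_exp_lt hb, div_lt_iff₀ hα, mul_comm] at h

end
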